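/- Let α, β ∈ ℂ be algebraically independent over ℚ. Let L be a differential field extension of ℂ(t) with derivation D, K a differential subfield of L, n ≥ 2, and let y₁, …, yₙ ∈ L be solutions (with each yᵢ ≠ 0) of the fourth Painlevé equation y'' = (1/(2y))(y')² + (3/2)y³ + 4ty² + 2(t² − α)y + β/y. If the 2n elements y₁, y₁', …, yₙ, yₙ' are NOT algebraically independent over K, then there exist 1 ≤ i < j ≤ n such that yᵢ, yᵢ', yⱼ, yⱼ' are not algebraically independent over K. (Geometric triviality part of Proposition 3.12.) -/

import Mathlib

section GenericFourthPainleve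

open Polynomial

section TopOperator

variable {k : Type*} [Field k]

/-- The operator `p ↦ 3 x (x + 1) p' - ν (2 x + 1) p`, which governs the leading forms of the
fourth Painlevé vector field. -/
noncomputable def topOp (ν : k) (p : k[X]) : k[X] :=
  3 * (X * (X + 1)) * derivative p - C ν * ((2 * X + 1) * p)

lemma topOp_mul (ν : k) (p : k[X]) :
    topOp (ν + 3) (X * (X + 1) * p) = X * (X + 1) * topOp ν p := by
  simp only [topOp, derivative_mul, derivative_X, derivative_add, derivative_one, C_add]
  have : (C (3 : k) : k[X]) = 3 := rfl
  rw [this]; ring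

lemma topOp_add (ν : k) (p q : k[X]) : topOp ν (p + q) = topOp ν p + topOp ν q := by
  simp only [topOp, derivative_add]; ring

lemma topOp_C_mul (ν c : k) (p : k[X]) : topOp ν (C c * p) = C c * topOp ν p := by
  simp only [topOp, derivative_C_mul]; ring

lemma topOp_coeff (ν : k) (p : k[X]) :
    (topOp ν p).coeff (p.natDegree + 1) = (3 * p.natDegree - 2 * ν) * p.leadingCoeff := by
  have e : topOp ν p = C 3 * (X * (X * derivative p)) + C 3 * (X * derivative p)
      - C ν * (C 2 * (X * p)) - C ν * p := by
    have h3 : (C (3 : k) : k[X]) = 3 := rfl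
    have h2 : (C (2 : k) : k[X]) = 2 := rfl
    rw [topOp, h3, h2]; ring
  have h1 : p.coeff (p.natDegree + 1) = 0 := coeff_eq_zero_of_natDegree_lt (by simp)
  have h2 : (X * derivative p).coeff p.natDegree = p.natDegree * p.leadingCoeff := by
    rcases h : p.natDegree with _ | n
    · simp
    · rw [coeff_X_mul, coeff_derivative, leadingCoeff, h]; push_cast; ring
  have h3 : (X * derivative p).coeff (p.natDegree + 1) = 0 := by
    rw [coeff_X_mul, coeff_derivative, h1]; simp
  rw [e]
  simp only [coeff_add, coeff_sub, coeff_C_mul, coeff_X_mul, h1, h2, h3]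
  rw [leadingCoeff]; ring

lemma exists_eq_mul_of_topOp {ν : k} (hν : ν ≠ 0) {p q : k[X]}
    (h : topOp ν p = X * (X + 1) * q) : ∃ p₁, p = X * (X + 1) * p₁ := by
  have h0 : p.eval 0 = 0 := by
    have := congrArg (eval 0) h
    simpa [topOp, hν] using this
  have h1 : p.eval (-1) = 0 := by
    have := congrArg (eval (-1)) h
    simp only [topOp, eval_sub, eval_mul, eval_add, eval_X, eval_one, eval_C, eval_ofNat] at this
    have h2 : ν * p.eval (-1) = 0 := by linear_combination this
    exact (mul_eq_zero.1 h2).resolve_left hν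
  have d0 : (X : k[X]) ∣ p := by
    have := dvd_iff_isRoot.2 (show IsRoot p 0 from h0); simpa using this
  have d1 : (X + 1 : k[X]) ∣ p := by
    have := dvd_iff_isRoot.2 (show IsRoot p (-1) from h1); simpa using this
  have hc : IsCoprime (X : k[X]) (X + 1) := ⟨-1, 1, by ring⟩
  exact hc.mul_dvd d0 d1

lemma X_mul_X_add_one_ne_zero : (X * (X + 1) : k[X]) ≠ 0 :=
  mul_ne_zero X_ne_zero (by simpa using X_add_C_ne_zero (1 : k))

variable [CharZero k]

lemma topOp_eq_const {i : ℕ} (hi : i = 1 ∨ i = 2) (r : ℕ) {c : k} {p : k[X]}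
    (h : topOp (3 * r - i : k) p = C c * (X * (X + 1)) ^ r) : p = 0 ∧ c = 0 := by
  induction r generalizing p with
  | zero =>
    by_cases hp : p = 0
    · subst hp
      refine ⟨rfl, ?_⟩
      have : C c = 0 := by simpa [topOp, eq_comm] using h
      exact C_eq_zero.1 this
    · exfalso
      have := topOp_coeff (3 * (0 : ℕ) - i : k) p
      rw [h] at this
      simp only [pow_zero, mul_one, coeff_C_succ] at this
      rcases mul_eq_zero.1 this.symm with h0 | h0
      · have h4 : ((3 * p.natDegree + 2 * i : ℕ) : k) = 0 := by
          push_cast at h0 ⊢; linear_combination h0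
        rw [Nat.cast_eq_zero] at h4; omega
      · exact hp (leadingCoeff_eq_zero.1 h0)
  | succ r ih =>
    have hν : (3 * (r + 1 : ℕ) - i : k) ≠ 0 := by
      have : ((3 * (r + 1) : ℕ) : k) ≠ (i : ℕ) := by
        rw [Ne, Nat.cast_inj]; omega
      intro h0; apply this; push_cast at h0 ⊢; linear_combination h0
    obtain ⟨p₁, rfl⟩ := exists_eq_mul_of_topOp hν (q := C c * (X * (X + 1)) ^ r)
      (by rw [h]; ring)
    have e : (3 * (r + 1 : ℕ) - i : k) = (3 * r - i : k) + 3 := by push_cast; ring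
    rw [e, topOp_mul, pow_succ] at h
    have := ih (p := p₁) (mul_left_cancel₀ X_mul_X_add_one_ne_zero (by rw [h]; ring))
    simp [this.1, this.2]

lemma eq_pow_of_topOp_eq_zero (r : ℕ) {p : k[X]} (h : topOp (3 * r : k) p = 0) :
    ∃ c, p = C c * (X * (X + 1)) ^ r := by
  induction r generalizing p with
  | zero =>
    have h1 : derivative p = 0 := by
      have h2 : 3 * (X * (X + 1)) * derivative p = 0 := by simpa [topOp] using h
      refine (mul_eq_zero.1 h2).resolve_left (mul_ne_zero ?_ X_mul_X_add_one_ne_zero)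
      have h3 : (C (3 : k) : k[X]) ≠ 0 := by simp
      exact h3
    exact ⟨p.coeff 0, by simpa using eq_C_of_derivative_eq_zero h1⟩
  | succ r ih =>
    have hν : (3 * (r + 1 : ℕ) : k) ≠ 0 :=
      mul_ne_zero three_ne_zero (Nat.cast_ne_zero.2 r.succ_ne_zero)
    obtain ⟨p₁, rfl⟩ := exists_eq_mul_of_topOp hν (q := 0) (by rw [h]; ring)
    have e : (3 * (r + 1 : ℕ) : k) = (3 * r : k) + 3 := by push_cast; ring
    rw [e, topOp_mul] at h
    obtain ⟨c, hc⟩ := ih ((mul_eq_zero.1 h).resolve_left X_mul_X_add_one_ne_zero)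
    exact ⟨c, by rw [hc]; ring⟩

lemma three_dvd_of_topOp_eq_zero {n : ℕ} {p : k[X]} (hp : p ≠ 0) (h : topOp (n : k) p = 0) :
    3 ∣ n := by
  by_contra hn
  have : n = 3 * (n / 3 + 1) - (3 - n % 3) := by omega
  have e : (n : k) = 3 * (n / 3 + 1 : ℕ) - (3 - n % 3 : ℕ) := by
    rw [eq_sub_iff_add_eq]; norm_cast; omega
  rw [e] at h
  exact hp (topOp_eq_const (i := 3 - n % 3) (c := 0) (by omega) _ (by rw [h]; simp)).1

/-- Solutions of a first order equation with simple poles are products of powers. -/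
lemma exists_eq_of_derivative {u l : k[X]} (hu : u ≠ 0) (hl : l.natDegree ≤ 1)
    (h : 3 * (X * (X + 1)) * derivative u = l * u) :
    ∃ (a e : ℕ) (c : k), c ≠ 0 ∧ u = C c * (X ^ a * (X + 1) ^ e) ∧
      l = 3 * (C (a : k) * (X + 1) + C (e : k) * X) := by
  obtain ⟨u₁, h1, h1'⟩ := exists_eq_pow_rootMultiplicity_mul_and_not_dvd u hu 0
  have hu1 : u₁ ≠ 0 := by rintro rfl; simp at h1'
  obtain ⟨r, h2, h2'⟩ := exists_eq_pow_rootMultiplicity_mul_and_not_dvd u₁ hu1 (-1)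
  have hr : r ≠ 0 := by rintro rfl; simp at h2'
  have h2x : ¬ X ∣ r := fun hd => h1' (by rw [h2, C_0, sub_zero]; exact hd.mul_left _)
  simp only [C_0, sub_zero, C_neg, C_1, sub_neg_eq_add] at h1 h2 h2'
  set a := rootMultiplicity 0 u
  set e := rootMultiplicity (-1) u₁
  have hX1 : (X + 1 : k[X]) ≠ 0 := by simpa using X_add_C_ne_zero (1 : k)
  have hmain : X * (X + 1) * (3 * derivative r) =
      (l - 3 * (C (a : k) * (X + 1) + C (e : k) * X)) * r := by
    have hm : (X ^ a * (X + 1) ^ e : k[X]) ≠ 0 :=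
      mul_ne_zero (pow_ne_zero _ X_ne_zero) (pow_ne_zero _ hX1)
    apply mul_left_cancel₀ hm
    have ha : X * derivative (X ^ a : k[X]) = C (a : k) * X ^ a := by
      rcases a with _ | a
      · simp
      · rw [derivative_X_pow]; simp [pow_succ]; ring
    have he : (X + 1) * derivative ((X + 1) ^ e : k[X]) = C (e : k) * (X + 1) ^ e := by
      rcases e with _ | e
      · simp
      · rw [derivative_pow]; simp [pow_succ]; ring
    rw [h1, h2] at h
    simp only [derivative_mul] at h
    linear_combination h - 3 * (X + 1) * (X + 1) ^ e * r * ha - 3 * X * X ^ a * r * he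
  have hd0 : X ∣ l - 3 * (C (a : k) * (X + 1) + C (e : k) * X) :=
    (prime_X.dvd_or_dvd (a := l - 3 * (C (a : k) * (X + 1) + C (e : k) * X)) (b := r)
      ⟨_, by rw [← hmain, mul_assoc]⟩).resolve_right h2x
  have hp1 : Prime (X + 1 : k[X]) := by
    have := prime_X_sub_C (-1 : k); simpa using this
  have hd1 : (X + 1) ∣ l - 3 * (C (a : k) * (X + 1) + C (e : k) * X) :=
    (hp1.dvd_or_dvd (a := l - 3 * (C (a : k) * (X + 1) + C (e : k) * X)) (b := r)
      ⟨X * (3 * derivative r), by rw [← hmain]; ring⟩).resolve_right h2'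
  have hc : IsCoprime (X : k[X]) (X + 1) := ⟨-1, 1, by ring⟩
  have hl0 : l - 3 * (C (a : k) * (X + 1) + C (e : k) * X) = 0 := by
    by_contra hne
    have h3 := natDegree_le_of_dvd (hc.mul_dvd hd0 hd1) hne
    have h4 : (X * (X + 1) : k[X]).natDegree = 2 := by compute_degree!
    have h5 : (l - 3 * (C (a : k) * (X + 1) + C (e : k) * X)).natDegree ≤ 1 := by
      refine (natDegree_sub_le _ _).trans (max_le hl ?_)
      compute_degree
    omega
  have hr0 : derivative r = 0 := by
    rw [hl0, zero_mul] at hmain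
    simpa [X_ne_zero, hX1] using hmain
  have hrC := eq_C_of_derivative_eq_zero hr0
  refine ⟨a, e, r.coeff 0, ?_, ?_, sub_eq_zero.1 hl0⟩
  · intro h0; rw [h0, C_0] at hrC; exact hr hrC
  · rw [h1, h2, hrC]; simp; ring

end TopOperator

/-- An additive endomorphism of a commutative ring satisfying the Leibniz rule. -/
structure Der (R : Type*) [CommRing R] extends R →+ R where
  leibniz' : ∀ a b, toFun (a * b) = a * toFun b + b * toFun a

namespace Der

variable {R : Type*} [CommRing R]

instance : FunLike (Der R) R R where
  coe d := d.toFun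
  coe_injective d e h := by
    rcases d with ⟨d, hd⟩; rcases e with ⟨e, he⟩
    congr; ext x; exact congrFun h x

instance : AddMonoidHomClass (Der R) R R where
  map_add d := d.toAddMonoidHom.map_add
  map_zero d := d.toAddMonoidHom.map_zero

variable (d : Der R)

@[simp] lemma leibniz (a b : R) : d (a * b) = a * d b + b * d a := d.leibniz' a b

@[simp] lemma map_one : d 1 = 0 := by simpa using d.leibniz 1 1

@[simp] lemma map_natCast (n : ℕ) : d n = 0 := by
  induction n with
  | zero => simp
  | succ n ih => simp [ih]

@[simp] lemma map_ofNat (n : ℕ) [n.AtLeastTwo] : d (ofNat(n) : R) = 0 := d.map_natCast n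

lemma map_pow (a : R) (n : ℕ) : d (a ^ n) = n * a ^ (n - 1) * d a := by
  induction n with
  | zero => simp
  | succ n ih =>
    rcases n with _ | n
    · simp
    · rw [pow_succ, leibniz, ih]; simp; ring

end Der

section CoefficientDerivation

variable {R S : Type*} [CommRing R] [CommRing S]

/-- The derivation of `R[X]` applying `d` to every coefficient. -/
noncomputable def coeffDer (d : Der R) : Der R[X] where
  toFun p := p.sum fun n a => monomial n (d a)
  map_zero' := by simp
  map_add' p q := sum_add_index _ _ _ (by simp) (by simp)
  leibniz' p q := by
    have key (p q : R[X]) : (p + q).sum (fun n a => monomial n (d a)) =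
        p.sum (fun n a => monomial n (d a)) + q.sum (fun n a => monomial n (d a)) :=
      sum_add_index _ _ _ (by simp) (by simp)
    induction p using Polynomial.induction_on' with
    | add p₁ p₂ h₁ h₂ => rw [add_mul, key, key, h₁, h₂]; ring
    | monomial m a =>
      induction q using Polynomial.induction_on' with
      | add q₁ q₂ h₁ h₂ => rw [mul_add, key, key, h₁, h₂]; ring
      | monomial n b =>
        simp [monomial_mul_monomial, sum_monomial_index, add_comm]

@[simp] lemma coeffDer_coeff (d : Der R) (p : R[X]) (n : ℕ) :
    (coeffDer d p).coeff n = d (p.coeff n) := by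
  change (p.sum fun n a => monomial n (d a)).coeff n = _
  rw [sum_def, finsetSum_coeff]
  simp +contextual [coeff_monomial]

@[simp] lemma coeffDer_C (d : Der R) (a : R) : coeffDer d (C a) = C (d a) := by
  ext n; simp [coeff_C]; split_ifs <;> simp

@[simp] lemma coeffDer_X (d : Der R) : coeffDer d X = 0 := by
  ext n; simp [coeff_X]; split_ifs <;> simp

/-- The derivation `∂/∂X` of `R[X]`. -/
noncomputable def derivX (R : Type*) [CommRing R] : Der R[X] where
  toFun p := derivative p
  map_zero' := by simp
  map_add' := by simp
  leibniz' p q := by simp; ring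

@[simp] lemma derivX_apply (p : R[X]) : derivX R p = derivative p := rfl

/-- Two additive maps satisfying the Leibniz rule along `φ` agree if they agree on
constants and on `X`. -/
lemma leibniz_ext (φ : R[X] →+* S) (G H : R[X] → S)
    (hG : ∀ p q, G (p + q) = G p + G q) (hG' : ∀ p q, G (p * q) = φ p * G q + φ q * G p)
    (hH : ∀ p q, H (p + q) = H p + H q) (hH' : ∀ p q, H (p * q) = φ p * H q + φ q * H p)
    (hC : ∀ a, G (C a) = H (C a)) (hX : G X = H X) (p : R[X]) : G p = H p := by
  induction p using Polynomial.induction_on with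
  | C a => exact hC a
  | add p q hp hq => rw [hG, hH, hp, hq]
  | monomial n a ih =>
    rw [pow_succ, ← mul_assoc, hG', hH', ih, hX]

/-- The coefficients of a polynomial, extended by zero to negative indices. -/
noncomputable def intCoeff (q : R[X]) (n : ℤ) : R := if 0 ≤ n then q.coeff n.toNat else 0

lemma intCoeff_natCast (q : R[X]) (n : ℕ) : intCoeff q n = q.coeff n := by simp [intCoeff]

lemma intCoeff_neg (q : R[X]) {n : ℤ} (h : n < 0) : intCoeff q n = 0 := by
  simp [intCoeff, not_le.2 h]

@[simp] lemma intCoeff_add (p q : R[X]) (n : ℤ) :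
    intCoeff (p + q) n = intCoeff p n + intCoeff q n := by
  unfold intCoeff; split_ifs <;> simp

@[simp] lemma intCoeff_sub (p q : R[X]) (n : ℤ) :
    intCoeff (p - q) n = intCoeff p n - intCoeff q n := by
  unfold intCoeff; split_ifs <;> simp

@[simp] lemma intCoeff_C_mul (a : R) (q : R[X]) (n : ℤ) :
    intCoeff (C a * q) n = a * intCoeff q n := by
  unfold intCoeff; split_ifs <;> simp

@[simp] lemma intCoeff_X_mul (q : R[X]) (n : ℤ) : intCoeff (X * q) n = intCoeff q (n - 1) := by
  rcases lt_trichotomy n 0 with h | rfl | h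
  · rw [intCoeff_neg _ h, intCoeff_neg _ (by lia)]
  · simp [intCoeff]
  · obtain ⟨m, rfl⟩ : ∃ m : ℕ, n = m + 1 := ⟨(n - 1).toNat, by lia⟩
    rw [add_sub_cancel_right, intCoeff_natCast]
    have := intCoeff_natCast (X * q) (m + 1)
    push_cast at this
    rw [this, coeff_X_mul]

@[simp] lemma intCoeff_X_pow_mul (q : R[X]) (m : ℕ) (n : ℤ) :
    intCoeff (X ^ m * q) n = intCoeff q (n - m) := by
  induction m generalizing n with
  | zero => simp
  | succ m ih => rw [pow_succ', mul_assoc, intCoeff_X_mul, ih]; congr 1; push_cast; ring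

@[simp] lemma intCoeff_coeffDer (d : Der R) (q : R[X]) (n : ℤ) :
    intCoeff (coeffDer d q) n = d (intCoeff q n) := by
  unfold intCoeff; split_ifs <;> simp

@[simp] lemma intCoeff_X_mul_derivative (q : R[X]) (n : ℤ) :
    intCoeff (X * derivative q) n = n * intCoeff q n := by
  rcases lt_or_ge n 0 with h | h
  · rw [intCoeff_neg _ h, intCoeff_neg _ h, mul_zero]
  · obtain ⟨m, rfl⟩ := Int.eq_ofNat_of_zero_le h
    rw [intCoeff_natCast, intCoeff_natCast]
    rcases m with _ | m
    · simp
    · rw [coeff_X_mul, coeff_derivative]; push_cast; ring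

lemma intCoeff_of_natDegree_lt {q : R[X]} {n : ℤ} (h : (q.natDegree : ℤ) < n) :
    intCoeff q n = 0 := by
  obtain ⟨m, rfl⟩ := Int.eq_ofNat_of_zero_le (show 0 ≤ n by lia)
  rw [intCoeff_natCast]
  exact coeff_eq_zero_of_natDegree_lt (by exact_mod_cast h)

end CoefficientDerivation

section PainleveField

/-- A differential field with the parameters of the symmetric form of the fourth Painlevé
equation, assumed generic. -/
structure PainleveData (k : Type*) [Field k] where
  d : Der k
  s : k
  a₁ : k
  a₂ : k
  d_s : d s = -2
  d_a₁ : d a₁ = 0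
  d_a₂ : d a₂ = 0
  generic : ∀ a b e : ℕ, (a : k) * a₁ + b * a₂ + e * (-2 - a₁ - a₂) = 0 → a = 0 ∧ b = 0 ∧ e = 0

namespace PainleveData

variable {k : Type*} [Field k] (P : PainleveData k)

/-- The first component of the symmetric vector field. -/
noncomputable def field₁ : k[X][X] :=
  C X * C X + 2 * C X * X - C (C P.s) * C X + C (C P.a₁)

/-- The second component of the symmetric vector field. -/
noncomputable def field₂ : k[X][X] :=
  C (C P.s) * X + C (C P.a₂) - 2 * C X * X - X * X

/-- The derivation of `k[f₁][f₂]` defined by the symmetric vector field. -/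
noncomputable def der : Der k[X][X] where
  toFun p := coeffDer (coeffDer P.d) p + P.field₁ * coeffDer (derivX k) p
    + P.field₂ * derivative p
  map_zero' := by simp
  map_add' p q := by simp; ring
  leibniz' p q := by simp; ring

lemma der_apply (p : k[X][X]) : P.der p =
    coeffDer (coeffDer P.d) p + P.field₁ * coeffDer (derivX k) p + P.field₂ * derivative p := rfl

@[simp] lemma der_C_C (a : k) : P.der (C (C a)) = C (C (P.d a)) := by
  simp [der_apply]

@[simp] lemma der_C_X : P.der (C X) = P.field₁ := by simp [der_apply]

@[simp] lemma der_X : P.der X = P.field₂ := by simp [der_apply]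

/-- The substitution `f₁ = x T`, `f₂ = T`. -/
noncomputable def blowup (k : Type*) [Field k] : k[X][X] →+* k[X][X] :=
  eval₂RingHom (eval₂RingHom (C.comp C) (C X * X)) X

@[simp] lemma blowup_C_C (a : k) : blowup k (C (C a)) = C (C a) := by simp [blowup]

@[simp] lemma blowup_C_X : blowup k (C X) = C X * X := by simp [blowup]

@[simp] lemma blowup_X : blowup k X = X := by simp [blowup]

lemma blowup_coeff (p : k[X][X]) (n i : ℕ) :
    ((blowup k p).coeff n).coeff i = if i ≤ n then (p.coeff (n - i)).coeff i else 0 := by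
  induction p using Polynomial.induction_on' with
  | add p q hp hq => simp only [map_add, coeff_add, hp, hq]; split_ifs <;> simp
  | monomial m p =>
    induction p using Polynomial.induction_on' with
    | add p q hp hq => simp only [map_add, coeff_add, hp, hq]; split_ifs <;> simp
    | monomial j a =>
      have : blowup k (monomial m (monomial j a)) = monomial (j + m) (monomial j a) := by
        simp only [← C_mul_X_pow_eq_monomial]
        simp only [map_mul, map_pow, blowup_C_C, blowup_C_X, blowup_X]; ring
      rw [this]
      simp only [coeff_monomial]
      by_cases h1 : j = i
      · subst h1
        by_cases h2 : j ≤ n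
        · have : (j + m = n) ↔ m = n - j := by omega
          simp only [h2, if_true, this]
        · have : j + m ≠ n := by omega
          simp [h2, this]
      · split_ifs <;> simp [coeff_monomial, h1]

lemma blowup_injective : Function.Injective (blowup k) := by
  rw [injective_iff_map_eq_zero]
  intro p hp
  ext j i
  have := blowup_coeff p (j + i) i
  simp only [hp, coeff_zero, le_add_iff_nonneg_left, zero_le, if_true, add_tsub_cancel_right] at this
  simpa using this.symm

lemma natDegree_blowup_coeff (p : k[X][X]) (n : ℕ) : ((blowup k p).coeff n).natDegree ≤ n := by
  rw [natDegree_le_iff_coeff_eq_zero]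
  intro i hi
  rw [blowup_coeff, if_neg (by omega)]

/-- `T` times the derivation of the vector field in the coordinates `(x, T)`. -/
noncomputable def blowupDer : Der k[X][X] where
  toFun q := X * coeffDer (coeffDer P.d) q
    + (C (3 * (X * (X + 1))) * X ^ 2 - C (2 * (C P.s * X)) * X + C (C P.a₁ - C P.a₂ * X))
      * coeffDer (derivX k) q
    + (C (C P.s) * X ^ 2 + C (C P.a₂) * X - C (2 * X + 1) * X ^ 3) * derivative q
  map_zero' := by simp
  map_add' p q := by simp; ring
  leibniz' p q := by simp; ring

lemma blowupDer_apply (q : k[X][X]) : P.blowupDer q =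
    X * coeffDer (coeffDer P.d) q
    + (C (3 * (X * (X + 1))) * X ^ 2 - C (2 * (C P.s * X)) * X + C (C P.a₁ - C P.a₂ * X))
      * coeffDer (derivX k) q
    + (C (C P.s) * X ^ 2 + C (C P.a₂) * X - C (2 * X + 1) * X ^ 3) * derivative q := rfl

lemma blowupDer_blowup (p : k[X][X]) : P.blowupDer (blowup k p) = X * blowup k (P.der p) := by
  refine leibniz_ext (blowup k) (fun p => P.blowupDer (blowup k p))
    (fun p => X * blowup k (P.der p)) ?_ ?_ ?_ ?_ ?_ ?_ p
  · intro p q; simp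
  · intro p q; simp
  · intro p q; simp [mul_add]
  · intro p q; simp; ring
  · refine leibniz_ext ((blowup k).comp C) (fun p => P.blowupDer (blowup k (C p)))
      (fun p => X * blowup k (P.der (C p))) ?_ ?_ ?_ ?_ ?_ ?_
    · intro p q; simp
    · intro p q; simp
    · intro p q; simp [mul_add]
    · intro p q; simp; ring
    · intro a
      simp [blowupDer_apply]
    · have h3 : (C (3 : k[X]) : k[X][X]) = 3 := rfl
      have h2 : (C (2 : k[X]) : k[X][X]) = 2 := rfl
      have hb : blowup k 2 = 2 := _root_.map_ofNat _ 2
      simp [blowupDer_apply, field₁, h3, h2, hb]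
      ring
  · have h2 : (C (2 : k[X]) : k[X][X]) = 2 := rfl
    have hb : blowup k 2 = 2 := _root_.map_ofNat _ 2
    simp [blowupDer_apply, field₂, h2, hb]
    ring

lemma intCoeff_blowup_der (p : k[X][X]) (n : ℤ) :
    intCoeff (blowup k (P.der p)) n =
      topOp ((n - 1 : ℤ) : k) (intCoeff (blowup k p) (n - 1))
      + (coeffDer P.d (intCoeff (blowup k p) n)
        - 2 * C P.s * X * derivative (intCoeff (blowup k p) n)
        + C (n : k) * C P.s * intCoeff (blowup k p) n)
      + ((C P.a₁ - C P.a₂ * X) * derivative (intCoeff (blowup k p) (n + 1))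
        + C ((n + 1 : ℤ) : k) * C P.a₂ * intCoeff (blowup k p) (n + 1)) := by
  have h := congrArg (fun q => intCoeff q (n + 1)) (P.blowupDer_blowup p)
  simp only [intCoeff_X_mul, add_sub_cancel_right] at h
  rw [← h]
  set q := blowup k p
  have e : P.blowupDer q = X * coeffDer (coeffDer P.d) q
    + (X ^ 2 * (C (3 * (X * (X + 1))) * coeffDer (derivX k) q)
      - X * (C (2 * (C P.s * X)) * coeffDer (derivX k) q)
      + C (C P.a₁ - C P.a₂ * X) * coeffDer (derivX k) q)
    + (X * (C (C P.s) * (X * derivative q)) + C (C P.a₂) * (X * derivative q)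
      - X ^ 2 * (C (2 * X + 1) * (X * derivative q))) := by
    rw [blowupDer_apply]; ring
  rw [e]
  have hw := fun m => intCoeff_X_mul_derivative q m
  generalize X * derivative q = w at hw
  simp only [intCoeff_add, intCoeff_sub, intCoeff_X_mul, intCoeff_X_pow_mul, intCoeff_C_mul,
    intCoeff_coeffDer, hw, add_sub_cancel_right, derivX_apply, topOp]
  have e2 : n + 1 - (2 : ℕ) = n - 1 := by push_cast; ring
  rw [e2]
  have hc (m : ℤ) : (C (m : k) : k[X]) = (m : k[X]) := by simp
  rw [hc, hc, hc]
  push_cast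
  ring

end PainleveData

end PainleveField

section DarbouxPolynomials

variable {k : Type*} [Field k]

lemma derivative_X_pow_mul_X_add_one_pow (a e : ℕ) :
    X * (X + 1) * derivative (X ^ a * (X + 1) ^ e : k[X]) =
      (C (a : k) * (X + 1) + C (e : k) * X) * (X ^ a * (X + 1) ^ e) := by
  have ha : X * derivative (X ^ a : k[X]) = C (a : k) * X ^ a := by
    rcases a with _ | a
    · simp
    · rw [derivative_X_pow]; simp [pow_succ]; ring
  have he : (X + 1) * derivative ((X + 1) ^ e : k[X]) = C (e : k) * (X + 1) ^ e := by
    rcases e with _ | e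
    · simp
    · rw [derivative_pow]; simp [pow_succ]; ring
  rw [derivative_mul]
  linear_combination (X + 1) * (X + 1) ^ e * ha + X * X ^ a * he

lemma derivative_X_mul_X_add_one_pow (r : ℕ) :
    X * (X + 1) * derivative ((X * (X + 1)) ^ r : k[X]) =
      C (r : k) * (2 * X + 1) * (X * (X + 1)) ^ r := by
  rw [mul_pow, derivative_X_pow_mul_X_add_one_pow]; ring

lemma coeffDer_X_pow_mul_X_add_one_pow (d : Der k) (a e : ℕ) :
    coeffDer d (X ^ a * (X + 1) ^ e) = 0 := by
  simp [Der.map_pow]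

lemma topOp_mul_pow (r : ℕ) (j : k) (g : k[X]) :
    topOp (3 * r + j) (g * (X * (X + 1)) ^ r) =
      (X * (X + 1)) ^ r * (3 * (X * (X + 1)) * derivative g - C j * (2 * X + 1) * g) := by
  have h3 : (C (3 : k) : k[X]) = 3 := rfl
  have h := derivative_X_mul_X_add_one_pow (k := k) r
  have h0 : (C (3 * (r : k) + j) : k[X]) = 3 * C (r : k) + C j := by rw [C_add, C_mul, h3]
  rw [topOp, derivative_mul, h0]
  generalize (X * (X + 1) : k[X]) ^ r = w at *
  linear_combination 3 * g * h

lemma topOp_mul_of_derivative {h l : k[X]} {r d A E : k}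
    (hh : X * (X + 1) * derivative h = (C (r - A) * (X + 1) + C (r - E) * X) * h)
    (hl : l + C d * (2 * X + 1) = 3 * (C A * (X + 1) + C E * X)) (i : k) (p : k[X]) :
    topOp (3 * r - i) (h * p) = h * (topOp (d - i) p - l * p) := by
  have h3 : (C (3 : k) : k[X]) = 3 := rfl
  simp only [topOp, derivative_mul, C_sub, C_mul, h3] at *
  linear_combination 3 * p * hh + h * p * hl

variable [CharZero k] (P : PainleveData k)

namespace PainleveData

lemma eq_zero_of_darboux_expansion {u q₁ q₂ l : k[X]} {g₀ : k} {d : ℕ} (hu : u ≠ 0)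
    (hud : u.natDegree ≤ d) (hl : l.natDegree ≤ 1)
    (h0 : topOp (d : k) u = l * u)
    (h1 : topOp (d - 1 : k) q₁ + (coeffDer P.d u - 2 * C P.s * X * derivative u
      + C (d : k) * C P.s * u) = C g₀ * u + l * q₁)
    (h2 : topOp (d - 2 : k) q₂ + (coeffDer P.d q₁ - 2 * C P.s * X * derivative q₁
      + C (d - 1 : k) * C P.s * q₁) + ((C P.a₁ - C P.a₂ * X) * derivative u
      + C (d : k) * C P.a₂ * u) = C g₀ * q₁ + l * q₂) : d = 0 := by
  have hld : (l + C (d : k) * (2 * X + 1)).natDegree ≤ 1 := by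
    refine (natDegree_add_le _ _).trans (max_le hl ?_)
    compute_degree
  obtain ⟨a, e, c, hc, rfl, hl'⟩ := exists_eq_of_derivative hu hld
    (by rw [topOp] at h0; linear_combination h0)
  have hae : a + e ≤ d := by
    refine le_trans (le_of_eq ?_) hud
    have : ((X + 1 : k[X]) ^ e).natDegree = e := by
      rw [natDegree_pow, show (X + 1 : k[X]) = X + C 1 by simp, natDegree_X_add_C, mul_one]
    have hX1 : (X + 1 : k[X]) ≠ 0 := by simpa using X_add_C_ne_zero (1 : k)
    rw [natDegree_C_mul hc, natDegree_mul (pow_ne_zero _ X_ne_zero) (pow_ne_zero _ hX1),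
      natDegree_X_pow, this]
  set r := max a e
  have har : a ≤ r := le_max_left _ _
  have her : e ≤ r := le_max_right _ _
  obtain ⟨h, hdef⟩ : ∃ h : k[X], h = X ^ (r - a) * (X + 1) ^ (r - e) := ⟨_, rfl⟩
  have hh : X * (X + 1) * derivative h = (C (r - a : k) * (X + 1) + C (r - e : k) * X) * h := by
    rw [hdef, derivative_X_pow_mul_X_add_one_pow, Nat.cast_sub har, Nat.cast_sub her]
  have hh0 : coeffDer P.d h = 0 := by rw [hdef, coeffDer_X_pow_mul_X_add_one_pow]
  have hT (i : k) (p : k[X]) := topOp_mul_of_derivative hh hl' i p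
  obtain ⟨v, hv⟩ : ∃ v : k[X], v = X ^ a * (X + 1) ^ e := ⟨_, rfl⟩
  have hv' := derivative_X_pow_mul_X_add_one_pow (k := k) a e
  have hv0 := coeffDer_X_pow_mul_X_add_one_pow P.d a e
  have hhv : h * v = (X * (X + 1)) ^ r := by
    rw [hdef, hv, mul_pow]
    calc _ = (X ^ (r - a) * X ^ a) * ((X + 1) ^ (r - e) * (X + 1) ^ e) := by ring
      _ = _ := by rw [← pow_add, ← pow_add, Nat.sub_add_cancel har, Nat.sub_add_cancel her]
  rw [← hv] at hv' hv0 h0 h1 h2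
  have hw0 : coeffDer P.d ((X * (X + 1)) ^ r) = 0 := by
    rw [mul_pow, coeffDer_X_pow_mul_X_add_one_pow]
  have hw' := derivative_X_mul_X_add_one_pow (k := k) r
  have hTw (j : k) (g : k[X]) := topOp_mul_pow r j g
  have hf1 := fun c p => topOp_eq_const (k := k) (i := 1) (Or.inl rfl) (r + 1) (c := c) (p := p)
  have hf2 := fun c p => topOp_eq_const (k := k) (i := 2) (Or.inr rfl) (r + 2) (c := c) (p := p)
  simp only [pow_add _ r, pow_one] at hf1 hf2
  have hTs (ν : k) (p : k[X]) : topOp ν (X * (X + 1) * p) = X * (X + 1) * topOp (ν - 3) p := by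
    rw [← topOp_mul, sub_add_cancel]
  have h3C : (C (3 : k) : k[X]) = 3 := rfl
  have h2C : (C (2 : k) : k[X]) = 2 := rfl
  have h4C : (C (4 : k) : k[X]) = 4 := rfl
  generalize (X * (X + 1) : k[X]) ^ r = w at *
  simp only [Der.leibniz, coeffDer_C, derivative_C_mul, hv0] at h1 h2
  -- first correction
  obtain ⟨hp1, hG⟩ := hf1 (c * (g₀ - d * P.s + 2 * P.s * (a + e) - P.s * e) - P.d c)
    (X * (X + 1) * (h * q₁) + C (P.s * e * c) * (X * w)) (by
      have e1 : (3 * (r + 1 : ℕ) - (1 : ℕ) : k) = 3 * r + 2 := by push_cast; ring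
      have e2 : (3 * r + 2 - 3 : k) = 3 * r - 1 := by ring
      rw [topOp_add, topOp_C_mul, e1, hTw, hTs, e2, hT]
      simp only [C_mul, C_sub, C_add, h2C, derivative_X]
      linear_combination X * (X + 1) * h * h1 + 2 * C P.s * X * C c * h * hv' +
        (C g₀ * C c * X * (X + 1) - C (P.d c) * X * (X + 1) - C (d : k) * C P.s * C c * X * (X + 1)
          + 2 * C P.s * C c * X * (C (a : k) * (X + 1) + C (e : k) * X)) * hhv)
  have hX1 : (X + 1 : k[X]) ≠ 0 := by simpa using X_add_C_ne_zero (1 : k)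
  have hp : (X + 1) * (h * q₁) = - (C P.s * C (e : k) * C c) * w := by
    apply mul_left_cancel₀ (X_ne_zero (R := k))
    simp only [C_mul] at hp1
    linear_combination hp1
  have hp' := congrArg derivative hp
  have hp0 := congrArg (coeffDer P.d) hp
  simp only [Der.leibniz, map_add, coeffDer_X, Der.map_one, hh0, hw0, map_neg, coeffDer_C,
    Der.map_natCast, P.d_s, derivative_mul, derivative_X,
    derivative_one, derivative_C, C_0, h2C] at hp' hp0
  -- second correction
  obtain ⟨E₂, hE₂⟩ : ∃ E₂ : k, 2 * E₂ = e * (e - 1) := ⟨e * (e - 1) / 2, by field_simp⟩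
  have hE₂' := congrArg C hE₂
  have hG' := congrArg C hG
  simp only [C_mul, C_sub, C_add, C_1, C_0, h2C] at hE₂' hG'
  obtain ⟨-, hcl⟩ := hf2 (- (c * (a * P.a₁ + (d - a - e) * P.a₂ + e * (-2 - P.a₁ - P.a₂))))
    (X * (X + 1) * (X * (X + 1) * (h * q₂)) + C (-c) * ((C (E₂ * P.s * P.s) * (X * X)
      + C (a * P.a₁) * (X * ((X + 1) * (X + 1)))
      + C (e * (-2 - P.a₁ - P.a₂)) * (X * X * (X + 1))) * w)) (by
      have e1 : (3 * (r + 2 : ℕ) - (2 : ℕ) : k) = 3 * r + 4 := by push_cast; ring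
      have e2 : (3 * r + 4 - 3 - 3 : k) = 3 * r - 2 := by ring
      rw [topOp_add, topOp_C_mul, e1, hTw, hTs, hTs, e2, hT]
      simp only [C_mul, C_sub, C_add, C_neg, C_1, h2C, h4C, derivative_mul, derivative_add,
        derivative_sub, derivative_neg, derivative_ofNat, derivative_C, derivative_X,
        derivative_one] at *
      linear_combination (X * (X + 1)) ^ 2 * h * h2
        + X * (X + 1) * X * (C g₀ - (C (d : k) - 1) * C P.s) * hp - X * (X + 1) * X * hp0
        + 2 * C P.s * X ^ 2 * (X * (X + 1)) * hp' - 2 * C P.s * X ^ 3 * hp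
        - 2 * C P.s * X ^ 2 * (X + 1) * q₁ * hh
        - 2 * C P.s * X ^ 2
          * ((C (r : k) - C (a : k)) * (X + 1) + (C (r : k) - C (e : k)) * X) * hp
        - 2 * C P.s * (C P.s * C (e : k) * C c) * X ^ 2 * hw'
        - X * (X + 1) * h * (C P.a₁ - C P.a₂ * X) * C c * hv'
        - (X * (X + 1) * (C P.a₁ - C P.a₂ * X) * (C (a : k) * (X + 1) + C (e : k) * X) * C c
          + (X * (X + 1)) ^ 2 * C (d : k) * C P.a₂ * C c) * hhv
        - X * (X + 1) * X * C P.s * C (e : k) * w * hG'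
        - C c * w * C P.s ^ 2 * (X ^ 2 - X ^ 3) * hE₂')
  have hcl' : (a : k) * P.a₁ + (d - a - e : ℕ) * P.a₂ + e * (-2 - P.a₁ - P.a₂) = 0 := by
    rw [Nat.cast_sub (by omega), Nat.cast_sub (by omega)]
    exact (mul_eq_zero.1 (neg_eq_zero.1 hcl)).resolve_left hc
  have := P.generic _ _ _ hcl'
  omega

/-- The generic symmetric vector field has no Darboux polynomials. -/
theorem exists_eq_C_C_of_dvd_der {p : k[X][X]} (hp : p ≠ 0) (h : p ∣ P.der p) :
    ∃ c : k, p = C (C c) := by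
  obtain ⟨g, hg⟩ := h
  have hq0 : blowup k p ≠ 0 := fun h0 => hp (blowup_injective (by rw [h0, map_zero]))
  have hrec := P.intCoeff_blowup_der p
  have hqdeg := natDegree_blowup_coeff p
  have hgdeg := natDegree_blowup_coeff g
  rw [hg, map_mul] at hrec
  have hcst : (blowup k p).natDegree = 0 → ∃ c : k, p = C (C c) := by
    intro h0
    refine ⟨((blowup k p).coeff 0).coeff 0, blowup_injective ?_⟩
    rw [blowup_C_C, ← eq_C_of_natDegree_le_zero (hqdeg 0), ← eq_C_of_natDegree_eq_zero h0]
  apply hcst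
  generalize blowup k p = q at *
  generalize blowup k g = G at *
  set d := q.natDegree with hd
  have hvan : ∀ n : ℤ, (d : ℤ) < n → intCoeff q n = 0 :=
    fun n hn => intCoeff_of_natDegree_lt (by rw [← hd]; exact hn)
  have hG1 : G.natDegree ≤ 1 := by
    by_contra! hlt
    have hG0 : G ≠ 0 := by rintro rfl; simp at hlt
    have h1 := hrec ((q * G).natDegree : ℕ)
    rw [natDegree_mul hq0 hG0] at h1
    rw [hvan _ (by push_cast; lia), hvan _ (by push_cast; lia), hvan _ (by push_cast; lia),
      intCoeff_natCast, ← natDegree_mul hq0 hG0, coeff_natDegree] at h1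
    have : (q * G).leadingCoeff = 0 := by rw [h1]; simp [topOp]
    exact mul_ne_zero hq0 hG0 (leadingCoeff_eq_zero.1 this)
  obtain ⟨l, b, rfl⟩ := exists_eq_X_add_C_of_natDegree_le_one hG1
  have hl : l.natDegree ≤ 1 := by simpa using hgdeg 1
  have hb := eq_C_of_natDegree_le_zero (by simpa using hgdeg 0 : b.natDegree ≤ 0)
  set g₀ := b.coeff 0
  have e : q * (C l * X + C b) = X * (C l * q) + C b * q := by ring
  simp only [e, intCoeff_add, intCoeff_X_mul, intCoeff_C_mul] at hrec
  have hu : intCoeff q d = q.leadingCoeff := intCoeff_natCast q d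
  have r0 := hrec (d + 1)
  have r1 := hrec d
  have r2 := hrec (d - 1)
  simp only [add_sub_cancel_right, sub_add_cancel] at r0 r1 r2
  rw [hvan (d + 1) (by lia), hvan (d + 1 + 1) (by lia)] at r0
  rw [hvan (d + 1) (by lia)] at r1
  simp only [map_zero, mul_zero, add_zero, sub_zero] at r0 r1
  have e2 : (d : ℤ) - 1 - 1 = d - 2 := by ring
  rw [e2] at r2
  push_cast at r0 r1 r2
  rw [hu] at r0 r1 r2
  refine P.eq_zero_of_darboux_expansion (leadingCoeff_ne_zero.2 hq0) (hqdeg d) hl r0.symm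
    (q₁ := intCoeff q (d - 1)) (q₂ := intCoeff q (d - 2)) (g₀ := g₀) ?_ ?_
  · rw [← r1, ← hb]; ring
  · rw [← hb]; linear_combination -r2

end PainleveData

end DarbouxPolynomials

section LinearSystem

namespace PainleveData

variable {k : Type*} [Field k] [CharZero k] (P : PainleveData k)

lemma linear_first_correction {w : k[X]} {c c' ν μ ρ : k} {l : ℕ}
    (h : 3 * (X * (X + 1)) * (topOp (3 * l - 1 : k) w
        + (coeffDer P.d (C c * (X * (X + 1)) ^ l)
          - 2 * C P.s * X * derivative (C c * (X * (X + 1)) ^ l)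
          + C (3 * l : k) * C P.s * (C c * (X * (X + 1)) ^ l))
        + C ν * (C c * (X * (X + 1)) ^ l)) =
      C μ * (C P.s * X * (1 - X)) * (C c * (X * (X + 1)) ^ l)
        - C μ * (3 * (X * (X + 1))) * (C c' * (X * (X + 1)) ^ l)
        + C ρ * (2 * X * (X - 1)) * (X * (X + 1)) ^ l) :
    P.d c + ν * c + μ * c' = 0 ∧
      3 * (X + 1) * w = - C ((3 * l - μ) * P.s * c + 2 * ρ) * (X * (X + 1)) ^ l := by
  have hw0 : coeffDer P.d ((X * (X + 1)) ^ l) = 0 := by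
    rw [mul_pow, coeffDer_X_pow_mul_X_add_one_pow]
  have hw' := derivative_X_mul_X_add_one_pow (k := k) l
  have hTw := fun g => topOp_mul_pow (k := k) l 2 g
  have hTs (ν : k) (p : k[X]) : topOp ν (X * (X + 1) * p) = X * (X + 1) * topOp (ν - 3) p := by
    rw [← topOp_mul, sub_add_cancel]
  have h3C : (C (3 : k) : k[X]) = 3 := rfl
  have h2C : (C (2 : k) : k[X]) = 2 := rfl
  have hf := fun c p => topOp_eq_const (k := k) (i := 1) (Or.inl rfl) (l + 1) (c := c) (p := p)
  simp only [pow_succ] at hf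
  simp only [Der.leibniz, coeffDer_C, derivative_C_mul, hw0] at h
  generalize (X * (X + 1) : k[X]) ^ l = π at *
  obtain ⟨hp, hc⟩ := hf (-3 * (P.d c + ν * c + μ * c'))
    (C 3 * (X * (X + 1) * w) + C ((3 * l - μ) * P.s * c + 2 * ρ) * (X * π)) (by
      have e1 : (3 * (l + 1 : ℕ) - (1 : ℕ) : k) = 3 * l + 2 := by push_cast; ring
      have e2 : (3 * l + 2 - 3 : k) = 3 * l - 1 := by ring
      rw [topOp_add, topOp_C_mul, topOp_C_mul, e1, hTs, hTw, e2]
      simp only [C_mul, C_sub, C_add, C_neg, h2C, h3C, derivative_X] at *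
      linear_combination h + 6 * C P.s * X * C c * hw')
  refine ⟨by simpa using hc, mul_left_cancel₀ (X_ne_zero (R := k)) ?_⟩
  rw [h3C] at hp
  linear_combination hp

lemma linear_second_correction {w w₁ z : k[X]} {c c₁ ν m b b₁ : k} {l : ℕ}
    (hw : 3 * (X + 1) * w = - C b * (X * (X + 1)) ^ l)
    (hw₁ : 3 * (X + 1) * w₁ = - C b₁ * (X * (X + 1)) ^ l)
    (h1 : 3 * (X * (X + 1)) * (topOp (3 * l - 1 : k) w
        + (coeffDer P.d (C c * (X * (X + 1)) ^ l)
          - 2 * C P.s * X * derivative (C c * (X * (X + 1)) ^ l)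
          + C (3 * l : k) * C P.s * (C c * (X * (X + 1)) ^ l))
        + C ν * (C c * (X * (X + 1)) ^ l)) =
      C m * (C P.s * X * (1 - X)) * (C c * (X * (X + 1)) ^ l)
        - C m * (3 * (X * (X + 1))) * (C c₁ * (X * (X + 1)) ^ l))
    (h2 : 3 * (X * (X + 1)) * (topOp (3 * l - 2 : k) z
        + (coeffDer P.d w - 2 * C P.s * X * derivative w + C (3 * l - 1 : k) * C P.s * w)
        + ((C P.a₁ - C P.a₂ * X) * derivative (C c * (X * (X + 1)) ^ l)
          + C (3 * l : k) * C P.a₂ * (C c * (X * (X + 1)) ^ l))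
        + C ν * w)
      - 2 * C P.s * X * (topOp (3 * l - 1 : k) w
        + (coeffDer P.d (C c * (X * (X + 1)) ^ l)
          - 2 * C P.s * X * derivative (C c * (X * (X + 1)) ^ l)
          + C (3 * l : k) * C P.s * (C c * (X * (X + 1)) ^ l))
        + C ν * (C c * (X * (X + 1)) ^ l)) =
      C m * (C P.s * X * (1 - X)) * w
        + C m * (2 * C P.a₂ * X ^ 2 + 4 * C P.a₂ * X + 2 * C P.a₁ + 4 * C P.a₁ * X)
          * (C c * (X * (X + 1)) ^ l)
        - C m * (3 * (X * (X + 1))) * w₁) :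
    P.d b + ν * b - 2 * m * P.s * c₁ + m * b₁ = 0 := by
  have hπ0 : coeffDer P.d ((X * (X + 1)) ^ l) = 0 := by
    rw [mul_pow, coeffDer_X_pow_mul_X_add_one_pow]
  have hπ' := derivative_X_mul_X_add_one_pow (k := k) l
  have hTw := fun g => topOp_mul_pow (k := k) l 4 g
  have hTs (ν : k) (p : k[X]) : topOp ν (X * (X + 1) * p) = X * (X + 1) * topOp (ν - 3) p := by
    rw [← topOp_mul, sub_add_cancel]
  have h3C : (C (3 : k) : k[X]) = 3 := rfl
  have h2C : (C (2 : k) : k[X]) = 2 := rfl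
  have h4C : (C (4 : k) : k[X]) = 4 := rfl
  have hf := fun c p => topOp_eq_const (k := k) (i := 2) (Or.inr rfl) (l + 2) (c := c) (p := p)
  simp only [pow_succ] at hf
  simp only [Der.leibniz, coeffDer_C, derivative_C_mul, hπ0] at h1 h2
  have hwd := congrArg derivative hw
  have hwD := congrArg (coeffDer P.d) hw
  have n3 : coeffDer P.d (3 : k[X]) = 0 := Der.map_ofNat _ 3
  generalize (X * (X + 1) : k[X]) ^ l = π at *
  simp only [Der.leibniz, map_add, coeffDer_X, Der.map_one, n3, hπ0, map_neg, coeffDer_C,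
    derivative_mul, derivative_X, derivative_ofNat,
    derivative_one, derivative_C] at hwd hwD
  obtain ⟨y, hy⟩ : ∃ y, y = P.d b + ν * b - 2 * m * P.s * c₁ + m * b₁ := ⟨_, rfl⟩
  rw [← hy]
  obtain ⟨η, hη⟩ : ∃ η, 6 * η = -2 * m * P.s ^ 2 * c + m * P.s * b - 3 * P.s * b * (l - 1) :=
    ⟨(-2 * m * P.s ^ 2 * c + m * P.s * b - 3 * P.s * b * (l - 1)) / 6, by field_simp⟩
  have hη' := congrArg C hη
  have hy' := congrArg C hy
  obtain ⟨-, hc⟩ := hf (-y)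
    (C 3 * (X * (X + 1) * (X * (X + 1) * z)) + ((C (-y) * (X ^ 3 + X ^ 2) + C η * X ^ 2
      + C (c * (3 * l - 2 * m)) * (C P.a₂ * (X ^ 3 + X ^ 2) - C P.a₁ * (X ^ 2 + X))) * π)) (by
      have e1 : (3 * (l + 2 : ℕ) - (2 : ℕ) : k) = 3 * l + 4 := by push_cast; ring
      have e2 : (3 * l + 4 - 3 - 3 : k) = 3 * l - 2 := by ring
      rw [topOp_add, topOp_C_mul, e1, hTs, hTs, hTw, e2]
      simp only [C_mul, C_sub, C_add, C_neg, C_pow, C_1, h2C, h3C, h4C, derivative_X,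
        derivative_mul, derivative_add, derivative_sub, derivative_neg,
        derivative_C, derivative_X_pow, derivative_ofNat] at *
      rw [show (C 6 : k[X]) = 6 from rfl] at hη'
      refine mul_left_cancel₀ (C_ne_zero.2 (three_ne_zero (α := k)) : (3 : k[X]) ≠ 0) ?_
      push_cast
      simp only [map_ofNat, pow_one]
      linear_combination 3 * (X * (X + 1)) * h2 + 2 * C P.s * X * h1
        - 3 * X ^ 2 * (X + 1) * hwD + 6 * C P.s * X ^ 3 * (X + 1) * hwd
        + (- 3 * X ^ 2 * (X + 1) * ((3 * C (l : k) - 1) * C P.s + C ν)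
          + C m * C P.s * X ^ 2 * (1 - X) - 6 * C P.s * X ^ 3) * hw
        - 3 * C m * X ^ 2 * (X + 1) * hw₁
        + (- 9 * X * (X + 1) * (C P.a₁ - C P.a₂ * X) * C c - 6 * C P.s * X ^ 2 * C b) * hπ'
        + X ^ 2 * (1 - X) * π * hη' - 3 * X ^ 2 * (X + 1) * π * hy')
  simpa using hc

end PainleveData

end LinearSystem

section LinearSystemRecursion

namespace PainleveData

variable {k : Type*} [Field k] (P : PainleveData k)

/-- The diagonal coefficient of the linearised vector field. -/
noncomputable def lin₁₁ : k[X][X] := 2 * C X + 2 * X - C (C P.s)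

/-- The Wronskian of the vector field and the Euler field. -/
noncomputable def wronskian : k[X][X] := P.field₁ * X - C X * P.field₂

/-- The coefficient of `v₁` in the derivative of `f₂ v₁ - f₁ v₂`. -/
noncomputable def eulerCoeff₁ : k[X][X] := P.field₂ + X * P.lin₁₁ + C X * (2 * X)

/-- The coefficient of `v₂` in the derivative of `f₂ v₁ - f₁ v₂`. -/
noncomputable def eulerCoeff₂ : k[X][X] := - P.field₁ + X * (2 * C X) + C X * P.lin₁₁

/-- The coefficient of `v₁` in the derivative of `V₂ v₁ - V₁ v₂`. -/
noncomputable def fieldCoeff₁ : k[X][X] :=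
  P.der P.field₂ + P.field₂ * P.lin₁₁ + P.field₁ * (2 * X)

/-- The coefficient of `v₂` in the derivative of `V₂ v₁ - V₁ v₂`. -/
noncomputable def fieldCoeff₂ : k[X][X] :=
  - P.der P.field₁ + P.field₂ * (2 * C X) + P.field₁ * P.lin₁₁

lemma blowup_field₁ : blowup k P.field₁ =
    C (X ^ 2 + 2 * X) * X ^ 2 - C (C P.s * X) * X + C (C P.a₁) := by
  have hb : blowup k 2 = 2 := _root_.map_ofNat _ 2
  have h2 : (C (2 : k[X]) : k[X][X]) = 2 := rfl
  simp [field₁, hb, h2]; ring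

lemma blowup_field₂ : blowup k P.field₂ =
    C (C P.s) * X + C (C P.a₂) - C (2 * X + 1) * X ^ 2 := by
  have hb : blowup k 2 = 2 := _root_.map_ofNat _ 2
  have h2 : (C (2 : k[X]) : k[X][X]) = 2 := rfl
  simp [field₂, hb, h2]; ring

lemma blowup_lin₁₁ : blowup k P.lin₁₁ = C (2 * X + 2) * X - C (C P.s) := by
  have hb : blowup k 2 = 2 := _root_.map_ofNat _ 2
  have h2 : (C (2 : k[X]) : k[X][X]) = 2 := rfl
  simp [lin₁₁, hb, h2]; ring

lemma der_field₁ : P.der P.field₁ = 2 * C X * P.field₁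
    + 2 * (P.field₁ * X + C X * P.field₂) - C (C P.s) * P.field₁ + 2 * C X := by
  have h2 : P.der 2 = 0 := Der.map_ofNat _ 2
  have hs : P.der (C (C P.s)) = -2 := by rw [der_C_C, P.d_s, map_neg, map_neg]; rfl
  have ha : P.der (C (C P.a₁)) = 0 := by rw [der_C_C, P.d_a₁, map_zero, map_zero]
  conv_lhs => rw [field₁]
  simp only [map_add, map_sub, Der.leibniz, h2, hs, ha, der_C_X, der_X]
  ring

lemma der_field₂ : P.der P.field₂ = C (C P.s) * P.field₂ - 2 * X
    - 2 * (P.field₁ * X + C X * P.field₂) - 2 * X * P.field₂ := by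
  have h2 : P.der 2 = 0 := Der.map_ofNat _ 2
  have hs : P.der (C (C P.s)) = -2 := by rw [der_C_C, P.d_s, map_neg, map_neg]; rfl
  have ha : P.der (C (C P.a₂)) = 0 := by rw [der_C_C, P.d_a₂, map_zero, map_zero]
  conv_lhs => rw [field₂]
  simp only [map_add, map_sub, Der.leibniz, h2, hs, ha, der_C_X, der_X]
  ring

lemma blowup_wronskian : blowup k P.wronskian = C (3 * (X * (X + 1))) * X ^ 3
    - C (2 * C P.s * X) * X ^ 2 + C (C P.a₁ - C P.a₂ * X) * X := by
  have h2 : (C (2 : k[X]) : k[X][X]) = 2 := rfl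
  have h3 : (C (3 : k[X]) : k[X][X]) = 3 := rfl
  simp only [wronskian, map_sub, map_mul, blowup_field₁, blowup_field₂, blowup_C_X, blowup_X,
    map_add, map_pow, map_one, h2, h3]
  ring

lemma blowup_eulerCoeff_field : blowup k (P.eulerCoeff₁ * P.field₁ + P.eulerCoeff₂ * P.field₂) =
    C (C P.s * X * (1 - X)) * X ^ 3
    + C (2 * C P.a₂ * X ^ 2 + 4 * C P.a₂ * X + 2 * C P.a₁ + 4 * C P.a₁ * X) * X ^ 2
    - C (C P.s * (C P.a₁ + C P.a₂ * X)) * X := by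
  have hb : blowup k 2 = 2 := _root_.map_ofNat _ 2
  have h2 : (C (2 : k[X]) : k[X][X]) = 2 := rfl
  have h4 : (C (4 : k[X]) : k[X][X]) = 4 := rfl
  simp only [eulerCoeff₁, eulerCoeff₂, map_sub, map_mul, map_neg, blowup_field₁, blowup_field₂,
    blowup_lin₁₁, blowup_C_X, blowup_X, map_add, map_pow, map_one, h2, h4, hb]
  ring

lemma blowup_eulerCoeff_euler : blowup k (- (P.eulerCoeff₁ * C X + P.eulerCoeff₂ * X)) =
    C (C P.a₁ - C P.a₂ * X) * X - C (3 * (X * (X + 1))) * X ^ 3 := by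
  have hb : blowup k 2 = 2 := _root_.map_ofNat _ 2
  have h2 : (C (2 : k[X]) : k[X][X]) = 2 := rfl
  have h3 : (C (3 : k[X]) : k[X][X]) = 3 := rfl
  simp only [eulerCoeff₁, eulerCoeff₂, map_sub, map_mul, map_neg, blowup_field₁, blowup_field₂,
    blowup_lin₁₁, blowup_C_X, blowup_X, map_add, map_pow, map_one, h2, h3, hb]
  ring

lemma blowup_fieldCoeff_field : blowup k (P.fieldCoeff₁ * P.field₁ + P.fieldCoeff₂ * P.field₂) =
    C (2 * X * (X - 1)) * X ^ 3 - C (2 * (C P.a₁ + C P.a₂ * X)) * X := by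
  have hb : blowup k 2 = 2 := _root_.map_ofNat _ 2
  have h2 : (C (2 : k[X]) : k[X][X]) = 2 := rfl
  simp only [fieldCoeff₁, fieldCoeff₂, der_field₁, der_field₂, map_sub, map_mul, map_neg,
    blowup_field₁, blowup_field₂, blowup_C_C,
    blowup_lin₁₁, blowup_C_X, blowup_X, map_add, map_pow, map_one, h2, hb]
  ring

lemma blowup_fieldCoeff_euler : blowup k (- (P.fieldCoeff₁ * C X + P.fieldCoeff₂ * X)) =
    C (4 * X) * X ^ 2 := by
  have hb : blowup k 2 = 2 := _root_.map_ofNat _ 2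
  have h2 : (C (2 : k[X]) : k[X][X]) = 2 := rfl
  have h4 : (C (4 : k[X]) : k[X][X]) = 4 := rfl
  simp only [fieldCoeff₁, fieldCoeff₂, der_field₁, der_field₂, map_sub, map_mul, map_neg,
    blowup_field₁, blowup_field₂, blowup_C_C,
    blowup_lin₁₁, blowup_C_X, blowup_X, map_add, map_pow, map_one, h2, h4, hb]
  ring

variable {P} in
lemma intCoeff_of_linear_system {e₀ e₁ e₂ : k[X][X]} {ν μ j : k}
    (h : P.wronskian * (P.der e₁ + C (C ν) * e₁) =
      (C (C μ) * (P.eulerCoeff₁ * P.field₁ + P.eulerCoeff₂ * P.field₂)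
        + C (C j) * (- (P.fieldCoeff₁ * C X + P.fieldCoeff₂ * X))) * e₁
      + C (C μ) * (- (P.eulerCoeff₁ * C X + P.eulerCoeff₂ * X)) * e₂
      + C (C j) * (P.fieldCoeff₁ * P.field₁ + P.fieldCoeff₂ * P.field₂) * e₀) (n : ℤ) :
    3 * (X * (X + 1)) * (intCoeff (blowup k (P.der e₁)) n + C ν * intCoeff (blowup k e₁) n)
      - 2 * C P.s * X *
        (intCoeff (blowup k (P.der e₁)) (n + 1) + C ν * intCoeff (blowup k e₁) (n + 1))
      + (C P.a₁ - C P.a₂ * X) *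
        (intCoeff (blowup k (P.der e₁)) (n + 2) + C ν * intCoeff (blowup k e₁) (n + 2)) =
      C μ * (C P.s * X * (1 - X)) * intCoeff (blowup k e₁) n
      + C μ * (2 * C P.a₂ * X ^ 2 + 4 * C P.a₂ * X + 2 * C P.a₁ + 4 * C P.a₁ * X)
        * intCoeff (blowup k e₁) (n + 1)
      - C μ * (C P.s * (C P.a₁ + C P.a₂ * X)) * intCoeff (blowup k e₁) (n + 2)
      + C j * (4 * X) * intCoeff (blowup k e₁) (n + 1)
      - C μ * (3 * (X * (X + 1))) * intCoeff (blowup k e₂) n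
      + C μ * (C P.a₁ - C P.a₂ * X) * intCoeff (blowup k e₂) (n + 2)
      + C j * (2 * X * (X - 1)) * intCoeff (blowup k e₀) n
      - C j * (2 * (C P.a₁ + C P.a₂ * X)) * intCoeff (blowup k e₀) (n + 2) := by
  replace h := congrArg (blowup k) h
  rw [map_mul, blowup_wronskian, map_add, map_add, map_add, map_mul _ _ e₁, map_mul _ _ e₁,
    map_mul _ _ e₂, map_mul _ _ e₀,
    map_add, map_mul _ (C (C μ)), map_mul _ (C (C μ)), map_mul _ (C (C j)), map_mul _ (C (C j)),
    blowup_eulerCoeff_field, blowup_eulerCoeff_euler, blowup_fieldCoeff_field,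
    blowup_fieldCoeff_euler, blowup_C_C, blowup_C_C, blowup_C_C] at h
  generalize blowup k (P.der e₁) = d at *
  generalize blowup k e₁ = q₁ at *
  generalize blowup k e₂ = q₂ at *
  generalize blowup k e₀ = q₀ at *
  have key : X ^ 3 * (C (3 * (X * (X + 1))) * (d + C (C ν) * q₁))
      - X ^ 2 * (C (2 * C P.s * X) * (d + C (C ν) * q₁))
      + X * (C (C P.a₁ - C P.a₂ * X) * (d + C (C ν) * q₁)) =
      X ^ 3 * (C (C μ * (C P.s * X * (1 - X))) * q₁)
      + X ^ 2 * (C (C μ * (2 * C P.a₂ * X ^ 2 + 4 * C P.a₂ * X + 2 * C P.a₁ + 4 * C P.a₁ * X))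
        * q₁)
      - X * (C (C μ * (C P.s * (C P.a₁ + C P.a₂ * X))) * q₁)
      + X ^ 2 * (C (C j * (4 * X)) * q₁)
      - X ^ 3 * (C (C μ * (3 * (X * (X + 1)))) * q₂)
      + X * (C (C μ * (C P.a₁ - C P.a₂ * X)) * q₂)
      + X ^ 3 * (C (C j * (2 * X * (X - 1))) * q₀)
      - X * (C (C j * (2 * (C P.a₁ + C P.a₂ * X))) * q₀) := by
    simp only [C_mul (a := C μ), C_mul (a := C j)]
    linear_combination h
  replace key := congrArg (fun q => intCoeff q (n + 3)) key
  simp only [intCoeff_add, intCoeff_sub, intCoeff_X_mul, intCoeff_X_pow_mul, intCoeff_C_mul]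
    at key
  have e3 : n + 3 - (3 : ℕ) = n := by push_cast; ring
  have e2 : n + 3 - (2 : ℕ) = n + 1 := by push_cast; ring
  have e1 : n + 3 - 1 = n + 2 := by ring
  rw [e1, e2, e3] at key
  exact key

end PainleveData

end LinearSystemRecursion

section LinearSystemRecursion

namespace PainleveData

variable {k : Type*} [Field k] [CharZero k] (P : PainleveData k)

lemma eq_zero_of_ladder {c : ℕ → k} {m l : ℕ} {ν : k} (hm : 1 ≤ m) (hml : m ≤ l)
    (h : ∀ j ≤ m, P.d (c j) + ν * c j + (m - j : k) * c (j + 1) = 0)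
    (h0 : P.d ((3 * l - m) * P.s * c 0) + ν * ((3 * l - m) * P.s * c 0) - 2 * m * P.s * c 1
      + m * ((3 * l - (m - 1)) * P.s * c 1 + 2 * c 0) = 0) :
    ∀ j ≤ m, c j = 0 := by
  have hnat : P.d (3 * l - m : k) = 0 := by
    rw [map_sub, Der.leibniz, Der.map_natCast, Der.map_natCast, Der.map_ofNat]; simp
  have hne : ∀ j : ℕ, (3 * l - 2 * m + j : k) ≠ 0 := by
    intro j hj
    have : ((3 * l - 2 * m + j : ℕ) : k) = 0 := by
      rw [Nat.cast_add, Nat.cast_sub (by omega)]; push_cast; exact hj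
    rw [Nat.cast_eq_zero] at this
    omega
  have step : ∀ j ≤ m, P.s * (m - j) * c (j + 1) = -2 * (3 * l - 2 * m + j) * c j := by
    intro j
    induction j with
    | zero =>
      intro _
      have h1 := h 0 (Nat.zero_le _)
      simp only [Der.leibniz, hnat, P.d_s] at h0
      push_cast at h1 ⊢
      linear_combination -h0 + (3 * l - m : k) * P.s * h1
    | succ j ih =>
      intro hj
      have ih := ih (by omega)
      have h1 := h j (by omega)
      have h2 := h (j + 1) hj
      have hd := congrArg P.d ih
      have n1 : P.d (m - j : k) = 0 := by simp
      have n2 : P.d (-2 * (3 * l - 2 * m + j) : k) = 0 := by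
        simp [Der.leibniz]
      simp only [Der.leibniz, n1, n2, P.d_s] at hd
      have hmj : (m - j : k) ≠ 0 := sub_ne_zero.2 (by exact_mod_cast (show m ≠ j by omega))
      apply mul_left_cancel₀ hmj
      push_cast at *
      linear_combination -hd + (m - j : k) * P.s * h2 + 2 * (3 * l - 2 * m + j) * h1 - ν * ih
  have top : ∀ i ≤ m, c (m - i) = 0 := by
    intro i
    induction i with
    | zero =>
      intro _
      have := step m le_rfl
      rw [sub_self, mul_zero, zero_mul, eq_comm, mul_eq_zero] at this
      rw [Nat.sub_zero]
      exact this.resolve_left (mul_ne_zero (by norm_num) (hne m))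
    | succ i ih =>
      intro hi
      have h1 := step (m - (i + 1)) (by omega)
      rw [show m - (i + 1) + 1 = m - i by omega, ih (by omega), mul_zero, eq_comm,
        mul_eq_zero] at h1
      exact h1.resolve_left (mul_ne_zero (by norm_num) (hne _))
  intro j hj
  simpa [Nat.sub_sub_self hj] using top (m - j) (by omega)

/-- The coefficients of a binary form of degree `m` in the Euler field and the vector field,
evaluated at a horizontal section of weight `ν`. -/
def IsFormSystem (m : ℕ) (ν : k) (e : ℕ → k[X][X]) : Prop :=
  ∀ j ≤ m, P.wronskian * (P.der (e j) + C (C ν) * e j) =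
    (C (C (m - j : k)) * (P.eulerCoeff₁ * P.field₁ + P.eulerCoeff₂ * P.field₂)
      + C (C (j : k)) * (- (P.fieldCoeff₁ * C X + P.fieldCoeff₂ * X))) * e j
    + C (C (m - j : k)) * (- (P.eulerCoeff₁ * C X + P.eulerCoeff₂ * X)) * e (j + 1)
    + C (C (j : k)) * (P.fieldCoeff₁ * P.field₁ + P.fieldCoeff₂ * P.field₂) * e (j - 1)

variable {P} in
lemma IsFormSystem.exists_leadingCoeff {e : ℕ → k[X][X]} {m M : ℕ} {ν : k} (hm : 1 ≤ m)
    (h : P.IsFormSystem m ν e) (hM : ∀ j ≤ m, (blowup k (e j)).natDegree ≤ M)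
    (hne : ∃ j ≤ m, (blowup k (e j)).coeff M ≠ 0) :
    ∃ l : ℕ, ∃ c : k, c ≠ 0 ∧ M = 3 * l ∧ l < m ∧
      (blowup k (e 0)).coeff M = C c * (X * (X + 1)) ^ l := by
  have hvan : ∀ j ≤ m, ∀ n : ℤ, (M : ℤ) < n → intCoeff (blowup k (e j)) n = 0 :=
    fun j hj n hn => intCoeff_of_natDegree_lt (lt_of_le_of_lt (by exact_mod_cast hM j hj) hn)
  have hu : ∀ j, intCoeff (blowup k (e j)) M = (blowup k (e j)).coeff M :=
    fun j => intCoeff_natCast _ M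
  have hrec := fun j hj n => intCoeff_of_linear_system (h j hj) n
  have hder := fun j n => P.intCoeff_blowup_der (e j) n
  have hder2 : ∀ j ≤ m, intCoeff (blowup k (P.der (e j))) (M + 2) = 0 := by
    intro j hj
    rw [hder, hvan j hj _ (by lia), hvan j hj _ (by lia), hvan j hj _ (by lia)]
    simp [topOp]
  have hder3 : ∀ j ≤ m, intCoeff (blowup k (P.der (e j))) (M + 3) = 0 := by
    intro j hj
    rw [hder, hvan j hj _ (by lia), hvan j hj _ (by lia), hvan j hj _ (by lia)]
    simp [topOp]
  have hder1 : ∀ j ≤ m, intCoeff (blowup k (P.der (e j))) (M + 1) =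
      topOp (M : k) ((blowup k (e j)).coeff M) := by
    intro j hj
    rw [hder, add_sub_cancel_right, hu, hvan j hj (M + 1) (by lia), hvan j hj (M + 1 + 1) (by lia)]
    simp
  -- indices outside `0, …, m` only occur with a vanishing factor
  have hnext : ∀ j ≤ m, ∀ n : ℤ, (M : ℤ) < n →
      C (m - j : k) * intCoeff (blowup k (e (j + 1))) n = 0 := by
    intro j hj n hn
    rcases hj.eq_or_lt with rfl | hj
    · simp
    · rw [hvan _ hj _ hn, mul_zero]
  have hprev : ∀ j ≤ m, ∀ n : ℤ, (M : ℤ) < n →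
      C (j : k) * intCoeff (blowup k (e (j - 1))) n = 0 := by
    intro j hj n hn
    rw [hvan _ (by omega) _ hn, mul_zero]
  have hπ0 : (3 * (X * (X + 1)) : k[X]) ≠ 0 :=
    mul_ne_zero (C_ne_zero.2 (three_ne_zero (α := k)) : (3 : k[X]) ≠ 0) X_mul_X_add_one_ne_zero
  have order0 : ∀ j ≤ m, topOp (M : k) ((blowup k (e j)).coeff M) = 0 := by
    intro j hj
    have h1 := hrec j hj (M + 1)
    rw [show (M : ℤ) + 1 + 1 = M + 2 by ring, show (M : ℤ) + 1 + 2 = M + 3 by ring,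
      hder1 j hj, hder2 j hj, hder3 j hj, hvan j hj (M + 1) (by lia), hvan j hj (M + 2) (by lia),
      hvan j hj (M + 3) (by lia)] at h1
    refine (mul_eq_zero.1 ?_).resolve_left hπ0
    linear_combination h1 - 3 * (X * (X + 1)) * hnext j hj (M + 1) (by lia)
      + (C P.a₁ - C P.a₂ * X) * hnext j hj (M + 3) (by lia)
      + (2 * X * (X - 1)) * hprev j hj (M + 1) (by lia)
      - (2 * (C P.a₁ + C P.a₂ * X)) * hprev j hj (M + 3) (by lia)
  obtain ⟨l, rfl⟩ : 3 ∣ M := by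
    obtain ⟨j, hj, hj0⟩ := hne
    exact three_dvd_of_topOp_eq_zero hj0 (order0 j hj)
  have hc : ∀ j, ∃ c : k, j ≤ m → (blowup k (e j)).coeff (3 * l) = C c * (X * (X + 1)) ^ l := by
    intro j
    by_cases hj : j ≤ m
    · have := order0 j hj
      push_cast at this
      obtain ⟨c, hc⟩ := eq_pow_of_topOp_eq_zero l this
      exact ⟨c, fun _ => hc⟩
    · exact ⟨0, fun h => absurd h hj⟩
  choose c hc using hc
  have hd0 : ∀ j, intCoeff (blowup k (P.der (e j))) (3 * l : ℕ) = topOp (3 * l - 1 : k)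
      (intCoeff (blowup k (e j)) ((3 * l : ℕ) - 1))
        + (coeffDer P.d ((blowup k (e j)).coeff (3 * l))
          - 2 * C P.s * X * derivative ((blowup k (e j)).coeff (3 * l))
          + C (3 * l : k) * C P.s * ((blowup k (e j)).coeff (3 * l)))
        + ((C P.a₁ - C P.a₂ * X) * derivative (intCoeff (blowup k (e j)) ((3 * l : ℕ) + 1))
          + C (3 * l + 1 : k) * C P.a₂ * intCoeff (blowup k (e j)) ((3 * l : ℕ) + 1)) := by
    intro j
    have := hder j (3 * l : ℕ)
    rw [hu] at this
    rw [this]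
    push_cast
    rfl
  have order1 : ∀ j ≤ m, 3 * (X * (X + 1)) * (topOp (3 * l - 1 : k)
      (intCoeff (blowup k (e j)) ((3 * l : ℕ) - 1))
        + (coeffDer P.d (C (c j) * (X * (X + 1)) ^ l)
          - 2 * C P.s * X * derivative (C (c j) * (X * (X + 1)) ^ l)
          + C (3 * l : k) * C P.s * (C (c j) * (X * (X + 1)) ^ l))
        + C ν * (C (c j) * (X * (X + 1)) ^ l)) =
      C (m - j : k) * (C P.s * X * (1 - X)) * (C (c j) * (X * (X + 1)) ^ l)
        - C (m - j : k) * (3 * (X * (X + 1))) * (C (c (j + 1)) * (X * (X + 1)) ^ l)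
        + C (j * c (j - 1) : k) * (2 * X * (X - 1)) * (X * (X + 1)) ^ l := by
    intro j hj
    have h1 := hrec j hj (3 * l : ℕ)
    have hd := hd0 j
    rw [hvan j hj ((3 * l : ℕ) + 1) (by lia)] at hd
    have hn : C (m - j : k) * (blowup k (e (j + 1))).coeff (3 * l) =
        C (m - j : k) * (C (c (j + 1)) * (X * (X + 1)) ^ l) := by
      rcases hj.eq_or_lt with rfl | hj
      · simp
      · rw [hc _ hj]
    rw [hder1 j hj, hder2 j hj, order0 j hj, hd, hvan j hj ((3 * l : ℕ) + 1) (by lia),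
      hvan j hj ((3 * l : ℕ) + 2) (by lia), hu, hu, hu, hc j hj, hc (j - 1) (by omega)] at h1
    rw [C_mul (b := c (j - 1))]
    simp only [derivative_zero] at h1
    linear_combination h1 - 3 * (X * (X + 1)) * hn
      + (C P.a₁ - C P.a₂ * X) * hnext j hj _ (by lia : ((3 * l : ℕ) : ℤ) < (3 * l : ℕ) + 2)
      - (2 * (C P.a₁ + C P.a₂ * X)) * hprev j hj _ (by lia : ((3 * l : ℕ) : ℤ) < (3 * l : ℕ) + 2)
  have first := fun j hj => P.linear_first_correction (order1 j hj)
  have w0 := (first 0 (Nat.zero_le _)).2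
  have w1 := (first 1 hm).2
  have o0 := order1 0 (Nat.zero_le _)
  simp only [Nat.cast_zero, sub_zero, zero_mul, mul_zero, add_zero, map_zero, Nat.cast_one,
    zero_add] at w0 w1 o0
  have second := P.linear_second_correction (z := intCoeff (blowup k (e 0)) ((3 * l : ℕ) - 2))
    w0 w1 o0 (by
      have h2 := hrec 0 (Nat.zero_le _) ((3 * l : ℕ) - 1)
      rw [show ((3 * l : ℕ) : ℤ) - 1 + 1 = (3 * l : ℕ) by ring,
        show ((3 * l : ℕ) : ℤ) - 1 + 2 = (3 * l : ℕ) + 1 by ring, hd0,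
        hder1 0 (Nat.zero_le _), order0 0 (Nat.zero_le _), hder,
        show ((3 * l : ℕ) : ℤ) - 1 - 1 = (3 * l : ℕ) - 2 by ring,
        show ((3 * l : ℕ) : ℤ) - 1 + 1 = (3 * l : ℕ) by ring, hu, zero_add, Nat.cast_zero,
        hvan 0 (Nat.zero_le _) ((3 * l : ℕ) + 1) (by lia), 
          hvan (0 + 1) hm ((3 * l : ℕ) + 1) (by lia), hc 0 (Nat.zero_le _)] at h2
      push_cast at h2 ⊢
      simp only [derivative_zero, C_0, sub_zero] at h2
      linear_combination h2)
  by_cases hml : m ≤ l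
  · have := P.eq_zero_of_ladder hm hml (fun j hj => (first j hj).1) (by
      linear_combination second)
    obtain ⟨j, hj, hj0⟩ := hne
    rw [hc j hj, this j hj, C_0, zero_mul] at hj0
    exact absurd rfl hj0
  refine ⟨l, c 0, ?_, rfl, not_le.1 hml, hc 0 (Nat.zero_le _)⟩
  intro h0
  have hall : ∀ j ≤ m, c j = 0 := by
    intro j
    induction j with
    | zero => exact fun _ => h0
    | succ j ih =>
      intro hj
      have h1 := (first j (by omega)).1
      rw [ih (by omega), map_zero, mul_zero, zero_add, zero_add] at h1
      refine (mul_eq_zero.1 h1).resolve_left (sub_ne_zero.2 ?_)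
      exact_mod_cast (show m ≠ j by omega)
  obtain ⟨j, hj, hj0⟩ := hne
  rw [hc j hj, hall j hj, C_0, zero_mul] at hj0
  exact hj0 rfl

end PainleveData

end LinearSystemRecursion

section LinearSystemRecursion

namespace PainleveData

variable {k : Type*} [Field k] (P : PainleveData k)

lemma natDegree_blowup_field₂_le : (blowup k P.field₂).natDegree ≤ 2 := by
  rw [blowup_field₂]; compute_degree

lemma coeff_blowup_field₂ : (blowup k P.field₂).coeff 2 = - (2 * X + 1) := by
  rw [blowup_field₂]; simp only [coeff_add, coeff_sub, coeff_C_mul, coeff_X_pow, coeff_X, coeff_C]; norm_num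

variable [CharZero k]

lemma leadingCoeff_blowup_wronskian : (blowup k P.wronskian).leadingCoeff = 3 * (X * (X + 1)) := by
  have hπ0 : (3 * (X * (X + 1)) : k[X]) ≠ 0 :=
    mul_ne_zero (C_ne_zero.2 (three_ne_zero (α := k)) : (3 : k[X]) ≠ 0) X_mul_X_add_one_ne_zero
  have h3 : (blowup k P.wronskian).coeff 3 = 3 * (X * (X + 1)) := by
    rw [blowup_wronskian]
    simp only [coeff_add, coeff_sub, coeff_C_mul, coeff_X_pow, coeff_X]
    norm_num
  have hd : (blowup k P.wronskian).natDegree ≤ 3 := by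
    rw [blowup_wronskian]; compute_degree
  rw [leadingCoeff, natDegree_eq_of_le_of_coeff_ne_zero hd (by rwa [h3]), h3]

variable {P} in
theorem IsFormSystem.eq_zero {e : ℕ → k[X][X]} {m : ℕ} {ν : k} {c : k[X][X]} (hm : 1 ≤ m)
    (h : P.IsFormSystem m ν e) (hc : P.wronskian ^ m * c =
      ∑ j ∈ Finset.range (m + 1), P.field₂ ^ (m - j) * (- X) ^ j * (m.choose j : k[X][X]) * e j) :
    c = 0 := by
  classical
  by_contra hc0
  have hκ := P.leadingCoeff_blowup_wronskian
  have hπ0 : (3 * (X * (X + 1)) : k[X]) ≠ 0 :=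
    mul_ne_zero (C_ne_zero.2 (three_ne_zero (α := k)) : (3 : k[X]) ≠ 0) X_mul_X_add_one_ne_zero
  have hκ0 : P.wronskian ≠ 0 := by
    intro h0
    rw [h0, map_zero, leadingCoeff_zero] at hκ
    exact hπ0 hκ.symm
  obtain ⟨i, hi, hi0⟩ : ∃ j ≤ m, e j ≠ 0 := by
    by_contra! h0
    rw [Finset.sum_eq_zero (fun j hj => by
      rw [h0 j (by rw [Finset.mem_range] at hj; omega), mul_zero])] at hc
    exact mul_ne_zero (pow_ne_zero m hκ0) hc0 hc
  obtain ⟨a, ha, hmax⟩ := Finset.exists_max_image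
    ((Finset.range (m + 1)).filter fun j => e j ≠ 0) (fun j => (blowup k (e j)).natDegree)
    ⟨i, by simpa [hi0] using Nat.lt_succ_of_le hi⟩
  simp only [Finset.mem_filter, Finset.mem_range, Nat.lt_succ_iff] at ha hmax
  set M := (blowup k (e a)).natDegree
  have hM : ∀ j ≤ m, (blowup k (e j)).natDegree ≤ M := by
    intro j hj
    by_cases h0 : e j = 0
    · simp [h0]
    · exact hmax j ⟨hj, h0⟩
  obtain ⟨l, c₀, hc₀, -, hl, hlc⟩ := h.exists_leadingCoeff hm hM ⟨a, ha.1, by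
    rw [← leadingCoeff, leadingCoeff_ne_zero, map_ne_zero_iff _ blowup_injective]; exact ha.2⟩
  replace hc := congrArg (blowup k) hc
  rw [map_mul, map_pow, map_sum] at hc
  have hdeg : ∀ j ≤ m, (blowup k (P.field₂ ^ (m - j) * (- X) ^ j * (m.choose j : k[X][X])
      * e j)).natDegree ≤ 2 * m - j + M := by
    intro j hj
    simp only [map_mul, map_pow, map_neg, blowup_X, map_natCast]
    refine natDegree_mul_le_of_le (natDegree_mul_le_of_le (n := 0) (m := 2 * m - j)
      (natDegree_mul_le_of_le (natDegree_pow_le_of_le _ P.natDegree_blowup_field₂_le)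
        (natDegree_pow_le_of_le (m := 1) _ (by rw [natDegree_neg]; exact natDegree_X_le)) |>.trans
        (by omega)) (natDegree_natCast _).le) (hM j hj)
  have hcoeff : (∑ j ∈ Finset.range (m + 1), blowup k (P.field₂ ^ (m - j) * (- X) ^ j
      * (m.choose j : k[X][X]) * e j)).coeff (2 * m + M) =
      (- (2 * X + 1)) ^ m * (C c₀ * (X * (X + 1)) ^ l) := by
    rw [finsetSum_coeff, Finset.sum_eq_single_of_mem 0 (by simp)]
    · have h2 : (blowup k P.field₂ ^ m).coeff (2 * m) = (- (2 * X + 1)) ^ m := by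
        rw [mul_comm, coeff_pow_of_natDegree_le P.natDegree_blowup_field₂_le, coeff_blowup_field₂]
      have hd : (blowup k P.field₂ ^ m).natDegree ≤ 2 * m := by
        rw [mul_comm]; exact natDegree_pow_le_of_le m P.natDegree_blowup_field₂_le
      rw [← h2, ← hlc]
      simpa using coeff_mul_add_eq_of_natDegree_le hd (hM 0 (Nat.zero_le _))
    · intro j hj hj0
      rw [Finset.mem_range] at hj
      exact coeff_eq_zero_of_natDegree_lt (lt_of_le_of_lt (hdeg j (by omega)) (by omega))
  have h21 : (- (2 * X + 1) : k[X]) ≠ 0 := by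
    intro h0
    simpa using congrArg (eval 0) h0
  have hne : (- (2 * X + 1)) ^ m * (C c₀ * (X * (X + 1)) ^ l) ≠ 0 :=
    mul_ne_zero (pow_ne_zero _ h21) (mul_ne_zero (C_ne_zero.2 hc₀)
      (pow_ne_zero _ X_mul_X_add_one_ne_zero))
  have hnat := natDegree_eq_of_le_of_coeff_ne_zero (natDegree_sum_le_of_forall_le _ _
    (fun j hj => (hdeg j (Nat.lt_succ_iff.1 (Finset.mem_range.1 hj))).trans
      (show 2 * m - j + M ≤ 2 * m + M by omega))) (by rw [hcoeff]; exact hne)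
  have hlead := congrArg leadingCoeff hc
  rw [leadingCoeff_mul, leadingCoeff_pow, hκ, leadingCoeff, leadingCoeff, hnat, hcoeff] at hlead
  obtain ⟨r, rfl⟩ := Nat.exists_eq_add_of_lt hl
  generalize (blowup k c).coeff (blowup k c).natDegree = u at hlead
  have h3 : (X * (X + 1) : k[X]) ^ l * (3 ^ (l + r + 1) * (X * (X + 1)) ^ (r + 1) * u) =
      (X * (X + 1) : k[X]) ^ l * ((- (2 * X + 1)) ^ (l + r + 1) * C c₀) := by
    rw [mul_pow, add_assoc, pow_add (X * (X + 1))] at hlead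
    rw [add_assoc]
    linear_combination hlead
  have h4 := congrArg (eval 0) (mul_left_cancel₀ (pow_ne_zero l X_mul_X_add_one_ne_zero) h3)
  simp at h4
  exact hc₀ h4

end PainleveData

end LinearSystemRecursion

section DerivationExtension

namespace Der

lemma mul_map_inv {E : Type*} [Field E] (D : Der E) {a : E} (ha : a ≠ 0) :
    D a⁻¹ = - (a⁻¹ * a⁻¹ * D a) := by
  have h := D.leibniz a a⁻¹
  rw [mul_inv_cancel₀ ha, D.map_one] at h
  apply mul_left_cancel₀ ha
  field_simp at h ⊢
  linear_combination -h

/-- The restriction of a derivation to a stable subring. -/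
noncomputable def restrict {R S : Type*} [CommRing R] [CommRing S] (f : R →+* S)
    (hf : Function.Injective f) (D : Der S) (h : ∀ a, D (f a) ∈ f.range) : Der R where
  toFun a := (h a).choose
  map_zero' := hf (by rw [(h 0).choose_spec]; simp)
  map_add' a b := hf (by rw [(h (a + b)).choose_spec]; simp [(h a).choose_spec, (h b).choose_spec])
  leibniz' a b := hf (by
    rw [(h (a * b)).choose_spec]; simp [(h a).choose_spec, (h b).choose_spec])

lemma map_restrict {R S : Type*} [CommRing R] [CommRing S] (f : R →+* S)
    (hf : Function.Injective f) (D : Der S) (h : ∀ a, D (f a) ∈ f.range) (a : R) :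
    f (restrict f hf D h a) = D (f a) := (h a).choose_spec

lemma trace_apply {F E : Type*} [Field F] [Field E] [Algebra F E] [FiniteDimensional F E]
    (d : Der F) (D : Der E) (h : ∀ a, D (algebraMap F E a) = algebraMap F E (d a)) (x : E) :
    Algebra.trace F E (D x) = d (Algebra.trace F E x) := by
  classical
  let b := Module.finBasis F E
  have key : ∀ z i, b.repr (D z) i = d (b.repr z i) + ∑ l, b.repr (D (b l)) i * b.repr z l := by
    intro z i
    conv_lhs => rw [← b.sum_repr z, map_sum]
    simp only [Algebra.smul_def, leibniz, h]
    simp only [mul_comm (b _) (algebraMap F E _), ← Algebra.smul_def, map_sum, map_add, map_smul,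
      Finsupp.coe_finsetSum, Finset.sum_apply, Finsupp.add_apply, Finsupp.smul_apply,
      Module.Basis.repr_self, Finset.sum_add_distrib, smul_eq_mul]
    rw [add_comm]
    congr 1
    · simp [Finsupp.single_apply]
    · exact Finset.sum_congr rfl fun l _ => mul_comm _ _
  have hmul : ∀ z i, b.repr (x * z) i = ∑ l, b.repr (x * b l) i * b.repr z l := by
    intro z i
    conv_lhs => rw [← b.sum_repr z, Finset.mul_sum]
    simp only [mul_smul_comm, map_sum, map_smul, Finsupp.coe_finsetSum, Finset.sum_apply,
      Finsupp.smul_apply, smul_eq_mul]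
    exact Finset.sum_congr rfl fun l _ => mul_comm _ _
  rw [Algebra.trace_eq_matrix_trace b, Algebra.trace_eq_matrix_trace b, Matrix.trace, Matrix.trace,
    map_sum]
  simp only [Matrix.diag_apply, Algebra.leftMulMatrix_eq_repr_mul]
  have hx : ∀ j, b.repr (D x * b j) j = d (b.repr (x * b j) j)
      + (∑ l, b.repr (D (b l)) j * b.repr (x * b j) l
        - ∑ l, b.repr (x * b l) j * b.repr (D (b j)) l) := by
    intro j
    rw [← hmul, show D x * b j = D (x * b j) - x * D (b j) by rw [leibniz]; ring, map_sub,
      Finsupp.sub_apply, key]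
    ring
  simp only [hx, Finset.sum_add_distrib, Finset.sum_sub_distrib]
  rw [Finset.sum_comm (f := fun j l => b.repr (x * b l) j * b.repr (D (b j)) l)]
  simp only [mul_comm (b.repr (x * b _) _), sub_self, add_zero]

end Der

lemma exists_trace_pow_ne_zero (F : Type*) {E : Type*} [Field F] [CharZero F] [Field E]
    [Algebra F E] [FiniteDimensional F E] {x : E} (hx : x ≠ 0) :
    ∃ m, 1 ≤ m ∧ Algebra.trace F E (x ^ m) ≠ 0 := by
  by_contra! h0
  have hxint : IsIntegral F x := Algebra.IsIntegral.isIntegral x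
  have h := congrArg (Algebra.trace F E) (minpoly.aeval F x)
  rw [aeval_eq_sum_range, map_sum, map_zero, Finset.sum_eq_single_of_mem 0 (by simp)
    (fun i _ hi => by rw [map_smul, h0 i (Nat.one_le_iff_ne_zero.2 hi), smul_zero])] at h
  rw [pow_zero, map_smul, ← map_one (algebraMap F E), Algebra.trace_algebraMap, smul_eq_mul,
    nsmul_eq_mul, mul_one, mul_eq_zero, Nat.cast_eq_zero] at h
  exact h.elim (minpoly.coeff_zero_ne_zero hxint hx) Module.finrank_pos.ne'

open IsLocalization in
/-- A finite family spanning a stable lattice over a unique factorization domain without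
nontrivial invariant principal ideals is integral. -/
theorem isInteger_of_stable {A F ι : Type*} [CommRing A] [IsDomain A] [UniqueFactorizationMonoid A]
    [Field F] [Algebra A F] [IsFractionRing A F] [Finite ι] (δ : Der A) (d : Der F)
    (h : ∀ a, d (algebraMap A F a) = algebraMap A F (δ a))
    (hδ : ∀ p : A, p ≠ 0 → p ∣ δ p → IsUnit p) (c : ι → F)
    (hc : ∀ q : A, (∀ i, IsInteger A (q • c i)) → ∀ i, IsInteger A (q • d (c i))) (i : ι) :
    IsInteger A (c i) := by
  have hinj := IsFractionRing.injective A F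
  obtain ⟨q, ⟨hq0, hq⟩, hmin⟩ := wellFounded_dvdNotUnit.has_min
    {q : A | q ≠ 0 ∧ ∀ i, IsInteger A (q • c i)} (by
      obtain ⟨b, hb⟩ := exist_integer_multiples_of_finite (nonZeroDivisors A) c
      exact ⟨b, nonZeroDivisors.coe_ne_zero b, hb⟩)
  have hq' : ∀ i, IsInteger A (δ q • c i) := by
    intro i
    obtain ⟨b, hb⟩ := hq i
    obtain ⟨b', hb'⟩ := hc q hq i
    refine ⟨δ b - b', ?_⟩
    rw [map_sub, ← h, hb, hb', Algebra.smul_def, Algebra.smul_def, Algebra.smul_def, Der.leibniz, h]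
    ring
  obtain ⟨a, a', g, hrel, hga, hga'⟩ := UniqueFactorizationMonoid.exists_reduced_factors q hq0 (δ q)
  have hg0 : g ≠ 0 := by rintro rfl; exact hq0 (by rw [← hga, zero_mul])
  have ha0 : a ≠ 0 := by rintro rfl; exact hq0 (by rw [← hga, mul_zero])
  have hg : ∀ i, IsInteger A (g • c i) := by
    intro i
    obtain ⟨b, hb⟩ := hq i
    obtain ⟨b', hb'⟩ := hq' i
    rw [Algebra.smul_def] at hb hb'
    obtain ⟨x, rfl⟩ : a ∣ b := by
      refine hrel.dvd_of_dvd_mul_left ⟨b', hinj ?_⟩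
      rw [map_mul, map_mul, hb, hb', ← hga', ← hga, map_mul, map_mul]
      ring
    refine ⟨x, mul_left_cancel₀ ((map_ne_zero_iff _ hinj).2 ha0) ?_⟩
    rw [← map_mul, hb, Algebra.smul_def, ← hga, map_mul]
    ring
  have hunit : IsUnit a := by
    by_contra hu
    exact hmin g ⟨hg0, hg⟩ ⟨hg0, a, hu, hga.symm⟩
  have hdvd : q ∣ δ q := by
    have : q ∣ g := by rw [← hga]; exact (hunit.mul_right_dvd).2 dvd_rfl
    exact this.trans ⟨a', hga'.symm⟩
  obtain ⟨u, hu⟩ := (hδ q hq0 hdvd).exists_left_inv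
  obtain ⟨b, hb⟩ := hq i
  refine ⟨u * b, ?_⟩
  rw [map_mul, hb, Algebra.smul_def, ← mul_assoc, ← map_mul, hu, map_one, one_mul]

end DerivationExtension

section LinearSystem

lemma Der.mul_map_pow_mul_pow {R : Type*} [CommRing R] (D : Der R) {κ μ g h α β γ δ : R}
    (hg : κ * (D g + μ * g) = α * g + β * h) (hh : κ * (D h + μ * h) = γ * g + δ * h) (a j : ℕ) :
    κ * (D (g ^ a * h ^ j) + (a + j) * μ * (g ^ a * h ^ j)) =
      (a * α + j * δ) * (g ^ a * h ^ j) + a * β * (g ^ (a - 1) * h ^ (j + 1))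
        + j * γ * (g ^ (a + 1) * h ^ (j - 1)) := by
  have h1 : (a : R) * (g ^ (a - 1) * g) = a * g ^ a := by
    rcases a with _ | a
    · simp
    · rw [Nat.add_sub_cancel, pow_succ]
  have h2 : (j : R) * (h ^ (j - 1) * h) = j * h ^ j := by
    rcases j with _ | j
    · simp
    · rw [Nat.add_sub_cancel, pow_succ]
  rw [D.leibniz, D.map_pow, D.map_pow, pow_succ g, pow_succ h]
  linear_combination a * g ^ (a - 1) * h ^ j * hg + j * g ^ a * h ^ (j - 1) * hh
    + (α - κ * μ) * h ^ j * h1 + (δ - κ * μ) * g ^ a * h2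

namespace PainleveData

variable {k : Type*} [Field k] [CharZero k] (P : PainleveData k)

lemma isUnit_of_dvd_der {p : k[X][X]} (hp : p ≠ 0) (h : p ∣ P.der p) : IsUnit p := by
  obtain ⟨c, rfl⟩ := P.exists_eq_C_C_of_dvd_der hp h
  rw [isUnit_C, isUnit_C, isUnit_iff_ne_zero]
  rintro rfl
  simp at hp

section

variable {F E : Type*} [Field F] [Algebra k[X][X] F] [IsFractionRing k[X][X] F] [Field E]
  [Algebra k[X][X] E] [Algebra F E] [IsScalarTower k[X][X] F E] [FiniteDimensional F E]

lemma trace_mem_range (D : Der E)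
    (hD : ∀ p, D (algebraMap k[X][X] E p) = algebraMap k[X][X] E (P.der p))
    (d : Der F) (hd : ∀ a, D (algebraMap F E a) = algebraMap F E (d a)) {α β γ δ : k[X][X]} {μ : k}
    {v₁ v₂ : E}
    (h₁ : D v₁ + algebraMap k[X][X] E (C (C μ)) * v₁ = algebraMap k[X][X] E α * v₁
      + algebraMap k[X][X] E β * v₂)
    (h₂ : D v₂ + algebraMap k[X][X] E (C (C μ)) * v₂ = algebraMap k[X][X] E γ * v₁
      + algebraMap k[X][X] E δ * v₂) (a j : ℕ) :
    Algebra.trace F E (v₁ ^ a * v₂ ^ j) ∈ (algebraMap k[X][X] F).range := by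
  have hτ : ∀ (p : k[X][X]) (x : E), Algebra.trace F E (algebraMap k[X][X] E p * x) =
      algebraMap k[X][X] F p * Algebra.trace F E x := fun p x => by
    rw [IsScalarTower.algebraMap_apply k[X][X] F E, ← Algebra.smul_def, map_smul, smul_eq_mul]
  have hdF : ∀ p, d (algebraMap k[X][X] F p) = algebraMap k[X][X] F (P.der p) := fun p =>
    (algebraMap F E).injective (by
      rw [← hd, ← IsScalarTower.algebraMap_apply, ← IsScalarTower.algebraMap_apply, hD])
  obtain ⟨m, hm⟩ : ∃ m, m = a + j := ⟨_, rfl⟩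
  have := isInteger_of_stable (ι := {x : ℕ × ℕ // x ∈ Finset.HasAntidiagonal.antidiagonal m}) P.der d hdF
    (fun p => P.isUnit_of_dvd_der)
    (fun x => Algebra.trace F E (v₁ ^ x.1.1 * v₂ ^ x.1.2)) (fun q hq ⟨⟨a, j⟩, hx⟩ => ?_)
    ⟨(a, j), Finset.HasAntidiagonal.mem_antidiagonal.2 hm.symm⟩
  · obtain ⟨b, hb⟩ := this
    exact ⟨b, hb⟩
  rw [Finset.HasAntidiagonal.mem_antidiagonal] at hx
  have hq' : ∀ b l, b + l = m → algebraMap k[X][X] F q * Algebra.trace F E (v₁ ^ b * v₂ ^ l) ∈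
      (algebraMap k[X][X] F).range := by
    intro b l hbl
    obtain ⟨z, hz⟩ := hq ⟨(b, l), Finset.HasAntidiagonal.mem_antidiagonal.2 hbl⟩
    exact ⟨z, hz.trans (Algebra.smul_def _ _)⟩
  have hder : D (v₁ ^ a * v₂ ^ j) =
      algebraMap k[X][X] E (a * α + j * δ - (a + j) * C (C μ)) * (v₁ ^ a * v₂ ^ j)
      + algebraMap k[X][X] E (a * β) * (v₁ ^ (a - 1) * v₂ ^ (j + 1))
      + algebraMap k[X][X] E (j * γ) * (v₁ ^ (a + 1) * v₂ ^ (j - 1)) := by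
    have := D.mul_map_pow_mul_pow (κ := 1) ((one_mul _).trans h₁) ((one_mul _).trans h₂) a j
    simp only [map_add, map_sub, map_mul, map_natCast]
    linear_combination this
  change _ ∈ (algebraMap k[X][X] F).range
  simp only [Algebra.smul_def]
  rw [← Der.trace_apply d D hd, hder, map_add, map_add, hτ, hτ, hτ, mul_add, mul_add]
  refine add_mem (add_mem ?_ ?_) ?_
  · rw [mul_left_comm]
    exact mul_mem ⟨_, rfl⟩ (hq' _ _ hx)
  · rcases a with _ | a
    · simp
    · rw [mul_left_comm]
      exact mul_mem ⟨_, rfl⟩ (hq' _ _ (by omega))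
  · rcases j with _ | j
    · simp
    · rw [mul_left_comm]
      exact mul_mem ⟨_, rfl⟩ (hq' _ _ (by omega))

/-- The linearised symmetric system twisted by `μ` has no nonzero solution in a finite extension. -/
lemma linear_system_eq_zero_of_finite (D : Der E)
    (hD : ∀ p, D (algebraMap k[X][X] E p) = algebraMap k[X][X] E (P.der p))
    (d : Der F) (hd : ∀ a, D (algebraMap F E a) = algebraMap F E (d a)) {μ : k} {v₁ v₂ : E}
    (h₁ : D v₁ + algebraMap k[X][X] E (C (C μ)) * v₁ = algebraMap k[X][X] E P.lin₁₁ * v₁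
      + algebraMap k[X][X] E (2 * C X) * v₂)
    (h₂ : D v₂ + algebraMap k[X][X] E (C (C μ)) * v₂ = algebraMap k[X][X] E (- (2 * X)) * v₁
      + algebraMap k[X][X] E (- P.lin₁₁) * v₂) :
    v₁ = 0 ∧ v₂ = 0 := by
  have hinjF := IsFractionRing.injective k[X][X] F
  have hinj : Function.Injective (algebraMap k[X][X] E) := by
    rw [IsScalarTower.algebraMap_eq k[X][X] F E]
    exact (algebraMap F E).injective.comp hinjF
  have hF : CharZero F := charZero_of_injective_ringHom hinjF
  suffices hv : v₂ = 0 by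
    refine ⟨?_, hv⟩
    have h2X : algebraMap k[X][X] E (- (2 * X)) ≠ 0 := by
      rw [map_ne_zero_iff _ hinj, neg_ne_zero]
      exact mul_ne_zero two_ne_zero X_ne_zero
    rw [hv, map_zero, mul_zero, mul_zero, add_zero, add_zero, eq_comm, mul_eq_zero] at h₂
    exact h₂.resolve_left h2X
  by_contra hv
  obtain ⟨m, hm, htr⟩ := exists_trace_pow_ne_zero F hv
  have hτ : ∀ (p : k[X][X]) (x : E), Algebra.trace F E (algebraMap k[X][X] E p * x) =
      algebraMap k[X][X] F p * Algebra.trace F E x := fun p x => by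
    rw [IsScalarTower.algebraMap_apply k[X][X] F E, ← Algebra.smul_def, map_smul, smul_eq_mul]
  have hpoly := P.trace_mem_range D hD d hd h₁ h₂
  set i := algebraMap k[X][X] E with hi
  set g : E := i X * v₁ - i (C X) * v₂ with hg
  set h : E := i P.field₂ * v₁ - i P.field₁ * v₂ with hh
  have hgh : ∀ n p a b : ℕ, Algebra.trace F E (v₁ ^ a * v₂ ^ b * g ^ n * h ^ p) ∈
      (algebraMap k[X][X] F).range := by
    intro n
    induction n with
    | zero =>
      intro p
      induction p with
      | zero => simpa using hpoly
      | succ p ih =>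
        intro a b
        rw [show v₁ ^ a * v₂ ^ b * g ^ 0 * h ^ (p + 1) =
          i P.field₂ * (v₁ ^ (a + 1) * v₂ ^ b * g ^ 0 * h ^ p)
          - i P.field₁ * (v₁ ^ a * v₂ ^ (b + 1) * g ^ 0 * h ^ p) by rw [pow_succ h]; rw [hh]; ring,
          map_sub, hτ, hτ]
        exact sub_mem (mul_mem ⟨_, rfl⟩ (ih _ _)) (mul_mem ⟨_, rfl⟩ (ih _ _))
    | succ n ih =>
      intro p a b
      rw [show v₁ ^ a * v₂ ^ b * g ^ (n + 1) * h ^ p =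
        i X * (v₁ ^ (a + 1) * v₂ ^ b * g ^ n * h ^ p)
        - i (C X) * (v₁ ^ a * v₂ ^ (b + 1) * g ^ n * h ^ p) by rw [pow_succ g]; rw [hg]; ring,
        map_sub, hτ, hτ]
      exact sub_mem (mul_mem ⟨_, rfl⟩ (ih _ _ _)) (mul_mem ⟨_, rfl⟩ (ih _ _ _))
  have hDg : i P.wronskian * (D g + i (C (C μ)) * g) =
      i (P.eulerCoeff₁ * P.field₁ + P.eulerCoeff₂ * P.field₂) * g
        + i (- (P.eulerCoeff₁ * C X + P.eulerCoeff₂ * X)) * h := by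
    rw [hg, map_sub, D.leibniz, D.leibniz, hD, hD, P.der_X, P.der_C_X]
    simp only [wronskian, eulerCoeff₁, eulerCoeff₂, lin₁₁, map_add, map_sub, map_mul, map_neg,
      map_ofNat] at h₁ h₂ ⊢
    rw [hh]
    linear_combination (i P.field₁ * i X - i (C X) * i P.field₂) * (i X * h₁ - i (C X) * h₂)
  have hDh : i P.wronskian * (D h + i (C (C μ)) * h) =
      i (P.fieldCoeff₁ * P.field₁ + P.fieldCoeff₂ * P.field₂) * g
        + i (- (P.fieldCoeff₁ * C X + P.fieldCoeff₂ * X)) * h := by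
    rw [hh, map_sub, D.leibniz, D.leibniz, hD, hD]
    simp only [wronskian, fieldCoeff₁, fieldCoeff₂, map_add, map_sub, map_mul, map_neg,
      map_ofNat] at h₁ h₂ ⊢
    linear_combination (i P.field₁ * i X - i (C X) * i P.field₂) *
      (i P.field₂ * h₁ - i P.field₁ * h₂)
  have hdF : ∀ p, d (algebraMap k[X][X] F p) = algebraMap k[X][X] F (P.der p) := fun p =>
    (algebraMap F E).injective (by
      rw [← hd, ← IsScalarTower.algebraMap_apply, ← IsScalarTower.algebraMap_apply, hD])
  choose e he using fun j => hgh (m - j) j 0 0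
  simp only [pow_zero, one_mul] at he
  obtain ⟨c, hc⟩ := hpoly 0 m
  rw [pow_zero, one_mul] at hc
  have hform : P.IsFormSystem m (m * μ) e := by
    intro j hj
    have hnext : g ^ (m - j - 1) * h ^ (j + 1) = g ^ (m - (j + 1)) * h ^ (j + 1) := by
      rw [Nat.sub_sub]
    have hprev : (j : E) * (g ^ (m - j + 1) * h ^ (j - 1)) =
        j * (g ^ (m - (j - 1)) * h ^ (j - 1)) := by
      rcases j with _ | j
      · simp
      · rw [show m - (j + 1) + 1 = m - (j + 1 - 1) by omega]
    have hcast : (C (C (m - j : k)) : k[X][X]) = ((m - j : ℕ) : k[X][X]) := by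
      rw [← Nat.cast_sub hj, map_natCast, map_natCast]
    have hcast' : ((m - j : ℕ) : E) + j = m := by rw [← Nat.cast_add, Nat.sub_add_cancel hj]
    have key := D.mul_map_pow_mul_pow hDg hDh (m - j) j
    rw [hnext, hcast'] at key
    replace key : i P.wronskian * D (g ^ (m - j) * h ^ j)
        + i (P.wronskian * C (C (m * μ))) * (g ^ (m - j) * h ^ j) =
      i (C (C (m - j : k)) * (P.eulerCoeff₁ * P.field₁ + P.eulerCoeff₂ * P.field₂)
        + C (C (j : k)) * (- (P.fieldCoeff₁ * C X + P.fieldCoeff₂ * X))) * (g ^ (m - j) * h ^ j)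
      + i (C (C (m - j : k)) * (- (P.eulerCoeff₁ * C X + P.eulerCoeff₂ * X)))
        * (g ^ (m - (j + 1)) * h ^ (j + 1))
      + i (C (C (j : k)) * (P.fieldCoeff₁ * P.field₁ + P.fieldCoeff₂ * P.field₂))
        * (g ^ (m - (j - 1)) * h ^ (j - 1)) := by
      rw [hcast, C_mul, C_mul]
      simp only [map_natCast, map_mul i, map_add i, map_neg i] at key hprev ⊢
      linear_combination key + (i P.fieldCoeff₁ * i P.field₁ + i P.fieldCoeff₂ * i P.field₂) * hprev
    replace key := congrArg (Algebra.trace F E) key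
    simp only [map_add (Algebra.trace F E), hτ, Der.trace_apply d D hd, ← he, hdF] at key
    apply hinjF
    simp only [map_mul (algebraMap k[X][X] F), map_add (algebraMap k[X][X] F)] at key ⊢
    linear_combination key
  have hsum : P.wronskian ^ m * c =
      ∑ j ∈ Finset.range (m + 1), P.field₂ ^ (m - j) * (- X) ^ j * (m.choose j : k[X][X]) * e j := by
    have hv2 : i P.wronskian * v₂ = i (- X) * h + i P.field₂ * g := by
      simp only [wronskian, hg, hh, map_sub, map_mul, map_neg]
      ring
    apply hinjF
    rw [map_mul, hc, ← hτ, map_pow i, ← mul_pow, hv2, add_pow, map_sum, map_sum]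
    refine Finset.sum_congr rfl fun j _ => ?_
    rw [map_mul (algebraMap k[X][X] F), he, ← hτ]
    congr 1
    simp only [map_mul, map_pow, map_natCast]
    ring_nf
  rw [hform.eq_zero hm hsum, map_zero] at hc
  exact htr hc.symm

end

end PainleveData

end LinearSystem

section LinearSystem

/-- The elements of a field whose derivative lies in a subfield containing them form a subfield. -/
def Der.preimageSubfield {E : Type*} [Field E] (D : Der E) (S : Subfield E) : Subfield E where
  carrier := {x | x ∈ S ∧ D x ∈ S}
  mul_mem' {a b} ha hb := ⟨mul_mem ha.1 hb.1, by
    rw [D.leibniz]; exact add_mem (mul_mem ha.1 hb.2) (mul_mem hb.1 ha.2)⟩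
  one_mem' := ⟨one_mem _, by rw [D.map_one]; exact zero_mem _⟩
  add_mem' {a b} ha hb := ⟨add_mem ha.1 hb.1, by rw [map_add]; exact add_mem ha.2 hb.2⟩
  zero_mem' := ⟨zero_mem _, by rw [map_zero]; exact zero_mem _⟩
  neg_mem' {a} ha := ⟨neg_mem ha.1, by rw [map_neg]; exact neg_mem ha.2⟩
  inv_mem' a ha := ⟨inv_mem ha.1, by
    rcases eq_or_ne a 0 with rfl | h0
    · rw [inv_zero, map_zero]; exact zero_mem _
    · rw [D.mul_map_inv h0]; exact neg_mem (mul_mem (mul_mem (inv_mem ha.1) (inv_mem ha.1)) ha.2)⟩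

namespace PainleveData

variable {k E : Type*} [Field k] [CharZero k] (P : PainleveData k) [Field E] [Algebra k[X][X] E]

lemma linear_system_eq_zero_of_isFractionRing (F : Type*) [Field F] [Algebra k[X][X] F]
    [IsFractionRing k[X][X] F] [Algebra F E] [IsScalarTower k[X][X] F E] (D : Der E)
    (hD : ∀ p, D (algebraMap k[X][X] E p) = algebraMap k[X][X] E (P.der p)) {μ : k} {v₁ v₂ : E}
    (h₁ : D v₁ + algebraMap k[X][X] E (C (C μ)) * v₁ = algebraMap k[X][X] E P.lin₁₁ * v₁
      + algebraMap k[X][X] E (2 * C X) * v₂)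
    (h₂ : D v₂ + algebraMap k[X][X] E (C (C μ)) * v₂ = algebraMap k[X][X] E (- (2 * X)) * v₁
      + algebraMap k[X][X] E (- P.lin₁₁) * v₂)
    (hv₁ : IsAlgebraic k[X][X] v₁) (hv₂ : IsAlgebraic k[X][X] v₂) :
    v₁ = 0 ∧ v₂ = 0 := by
  let E₀ := IntermediateField.adjoin F ({v₁, v₂} : Set E)
  have : IsScalarTower k[X][X] E₀ E := IsScalarTower.of_algebraMap_eq (fun _ => rfl)
  have hmem₁ : v₁ ∈ E₀ := IntermediateField.subset_adjoin _ _ (by simp)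
  have hmem₂ : v₂ ∈ E₀ := IntermediateField.subset_adjoin _ _ (by simp)
  have hA : ∀ p, algebraMap k[X][X] E p ∈ E₀ := fun p => by
    rw [IsScalarTower.algebraMap_apply k[X][X] F E]; exact E₀.algebraMap_mem _
  have hfin : FiniteDimensional F E₀ := IntermediateField.finiteDimensional_adjoin (by
    rintro x (rfl | rfl)
    · exact (hv₁.extendScalars (IsFractionRing.injective k[X][X] F)).isIntegral
    · exact (hv₂.extendScalars (IsFractionRing.injective k[X][X] F)).isIntegral)
  have hF : ∀ S : Subfield E, (∀ p, algebraMap k[X][X] E p ∈ S) → ∀ a, algebraMap F E a ∈ S := by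
    intro S hS a
    obtain ⟨x, y, -, rfl⟩ := IsFractionRing.div_surjective (A := k[X][X]) a
    rw [map_div₀, ← IsScalarTower.algebraMap_apply, ← IsScalarTower.algebraMap_apply]
    exact div_mem (hS x) (hS y)
  have hFd : ∀ a, D (algebraMap F E a) ∈ (algebraMap F E).range := fun a =>
    (hF (D.preimageSubfield (algebraMap F E).fieldRange) (fun p =>
      ⟨⟨algebraMap _ F p, (IsScalarTower.algebraMap_apply _ F E p).symm⟩,
        ⟨algebraMap _ F (P.der p), by rw [← IsScalarTower.algebraMap_apply, hD]⟩⟩) a).2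
  have hEd : ∀ x ∈ E₀, x ∈ D.preimageSubfield E₀.toSubfield := by
    intro x hx
    refine IntermediateField.adjoin_le_subfield F _ ?_ ?_ hx
    · rintro _ ⟨a, rfl⟩
      exact hF (D.preimageSubfield E₀.toSubfield) (fun p => ⟨hA p, by rw [hD]; exact hA _⟩) a
    · rintro x (rfl | rfl)
      · refine ⟨hmem₁, ?_⟩
        rw [eq_sub_of_add_eq h₁]
        exact sub_mem (add_mem (mul_mem (hA _) hmem₁) (mul_mem (hA _) hmem₂)) (mul_mem (hA _) hmem₁)
      · refine ⟨hmem₂, ?_⟩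
        rw [eq_sub_of_add_eq h₂]
        exact sub_mem (add_mem (mul_mem (hA _) hmem₁) (mul_mem (hA _) hmem₂)) (mul_mem (hA _) hmem₂)
  have hinj₀ := (algebraMap E₀ E).injective
  let d : Der F := D.restrict (algebraMap F E) (algebraMap F E).injective hFd
  let D₀ : Der E₀ := D.restrict (algebraMap E₀ E) hinj₀
    (fun x => ⟨⟨D x, (hEd x x.2).2⟩, rfl⟩)
  have hD₀ : ∀ x : E₀, algebraMap E₀ E (D₀ x) = D (algebraMap E₀ E x) := Der.map_restrict _ _ _ _
  have h := P.linear_system_eq_zero_of_finite (F := F) (E := E₀) D₀ (fun p => hinj₀ (by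
      rw [hD₀, ← IsScalarTower.algebraMap_apply, ← IsScalarTower.algebraMap_apply, hD])) d
    (fun a => hinj₀ (by
      rw [hD₀, ← IsScalarTower.algebraMap_apply, ← IsScalarTower.algebraMap_apply,
        Der.map_restrict])) (μ := μ) (v₁ := ⟨v₁, hmem₁⟩) (v₂ := ⟨v₂, hmem₂⟩)
    (hinj₀ (by
      simp only [map_add (algebraMap E₀ E), map_mul (algebraMap E₀ E), hD₀,
        ← IsScalarTower.algebraMap_apply]
      exact h₁))
    (hinj₀ (by
      simp only [map_add (algebraMap E₀ E), map_mul (algebraMap E₀ E), hD₀,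
        ← IsScalarTower.algebraMap_apply]
      exact h₂))
  exact ⟨congrArg Subtype.val h.1, congrArg Subtype.val h.2⟩

/-- The linearised symmetric system twisted by `μ` has no nonzero algebraic solution. -/
theorem linear_system_eq_zero (hinj : Function.Injective (algebraMap k[X][X] E)) (D : Der E)
    (hD : ∀ p, D (algebraMap k[X][X] E p) = algebraMap k[X][X] E (P.der p)) {μ : k} {v₁ v₂ : E}
    (h₁ : D v₁ + algebraMap k[X][X] E (C (C μ)) * v₁ = algebraMap k[X][X] E P.lin₁₁ * v₁
      + algebraMap k[X][X] E (2 * C X) * v₂)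
    (h₂ : D v₂ + algebraMap k[X][X] E (C (C μ)) * v₂ = algebraMap k[X][X] E (- (2 * X)) * v₁
      + algebraMap k[X][X] E (- P.lin₁₁) * v₂)
    (hv₁ : IsAlgebraic k[X][X] v₁) (hv₂ : IsAlgebraic k[X][X] v₂) :
    v₁ = 0 ∧ v₂ = 0 := by
  have : FaithfulSMul k[X][X] E := (faithfulSMul_iff_algebraMap_injective _ _).2 hinj
  let : Algebra (FractionRing k[X][X]) E := FractionRing.liftAlgebra k[X][X] E
  have : IsScalarTower k[X][X] (FractionRing k[X][X]) E :=
    FractionRing.isScalarTower_liftAlgebra k[X][X] E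
  exact P.linear_system_eq_zero_of_isFractionRing (FractionRing k[X][X]) D hD h₁ h₂ hv₁ hv₂

end PainleveData

end LinearSystem

section AlgebraicityViaDerivations

lemma Algebra.FormallySmooth.exists_ringHom_lift {R S B : Type*} [CommRing R] [CommRing S]
    [CommRing B] [Algebra R S] [Algebra.FormallySmooth R S] (π : B →+* S)
    (hπ : Function.Surjective π) (hker : IsNilpotent (RingHom.ker π)) (ψ : R →+* B)
    (hψ : ∀ a, π (ψ a) = algebraMap R S a) :
    ∃ σ : S →+* B, (∀ x, π (σ x) = x) ∧ ∀ a, σ (algebraMap R S a) = ψ a := by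
  let : Algebra R B := ψ.toAlgebra
  let g : B →ₐ[R] S := { π with commutes' := hψ }
  let σ := Algebra.FormallySmooth.liftOfSurjective (AlgHom.id R S) g hπ hker
  exact ⟨σ, fun x => Algebra.FormallySmooth.liftOfSurjective_apply (AlgHom.id R S) g hπ hker x,
    fun a => σ.commutes a⟩

lemma Der.exists_extension {R S : Type*} [CommRing R] [CommRing S] [Algebra R S]
    [Algebra.FormallySmooth R S] (δ : R → S) (hadd : ∀ a b, δ (a + b) = δ a + δ b)
    (hmul : ∀ a b, δ (a * b) = algebraMap R S a * δ b + algebraMap R S b * δ a) :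
    ∃ d : Der S, ∀ a, d (algebraMap R S a) = δ a := by
  have h0 : δ 0 = 0 := by simpa using hadd 0 0
  have h1 : δ 1 = 0 := by simpa using hmul 1 1
  let ψ : R →+* TrivSqZeroExt S S :=
    { toFun a := TrivSqZeroExt.inl (algebraMap R S a) + TrivSqZeroExt.inr (δ a)
      map_one' := by ext <;> simp [h1]
      map_mul' a b := by ext <;> simp [hmul, mul_comm]
      map_zero' := by ext <;> simp [h0]
      map_add' a b := by ext <;> simp [hadd] }
  let π : TrivSqZeroExt S S →+* S := (TrivSqZeroExt.fstHom S S S).toRingHom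
  have hπ (x) : π x = x.fst := rfl
  obtain ⟨σ, hσ, hσ'⟩ := Algebra.FormallySmooth.exists_ringHom_lift π
    (fun x => ⟨TrivSqZeroExt.inl x, rfl⟩) ⟨2, by
      rw [pow_two, Ideal.zero_eq_bot, eq_bot_iff, Ideal.mul_le]
      intro a ha b hb
      rw [RingHom.mem_ker, hπ] at ha hb
      ext <;> simp [ha, hb]⟩ ψ (fun a => by simp [hπ, ψ])
  simp only [hπ] at hσ
  refine ⟨{ toFun x := (σ x).snd
            map_zero' := by simp
            map_add' a b := by simp
            leibniz' a b := by simp [hσ, mul_comm] }, fun a => ?_⟩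
  change (σ (algebraMap R S a)).snd = _
  rw [hσ']; simp [ψ]

lemma Algebra.FormallySmooth.of_isAlgebraic_charZero {R L : Type*} [CommRing R] [IsDomain R]
    [Field L] [CharZero L] [Algebra R L] [FaithfulSMul R L] [Algebra.IsAlgebraic R L] :
    Algebra.FormallySmooth R L := by
  let := FractionRing.liftAlgebra R L
  have : Algebra.IsAlgebraic (FractionRing R) L :=
    (IsFractionRing.comap_isAlgebraic_iff (A := R) (K := FractionRing R)).mp inferInstance
  have : CharZero (FractionRing R) :=
    (algebraMap (FractionRing R) L).charZero
  have : Algebra.FormallySmooth R (FractionRing R) := .of_isLocalization (nonZeroDivisors R)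
  have : Algebra.FormallyEtale (FractionRing R) L := Algebra.FormallyEtale.of_isSeparable _ L
  exact .comp R (FractionRing R) L

lemma Der.exists_ne_zero_of_transcendental {A L : Type*} [CommRing A] [IsDomain A] [Field L]
    [CharZero L] [Algebra A L] {x : L} (hx : Transcendental A x) :
    ∃ d : Der L, (∀ a, d (algebraMap A L a) = 0) ∧ d x ≠ 0 := by
  classical
  have hx' : AlgebraicIndepOn A id ({x} : Set L) :=
    (algebraicIndependent_unique_type_iff).mpr (by simpa using hx)
  obtain ⟨t, hxt, ht⟩ := exists_isTranscendenceBasis_superset hx'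
  let i : t := ⟨x, hxt rfl⟩
  have := ht.isAlgebraic
  have : Algebra.FormallySmooth (Algebra.adjoin A (Set.range ((↑) : t → L))) L :=
    .of_isAlgebraic_charZero
  obtain ⟨d, hd⟩ := Der.exists_extension
    (R := Algebra.adjoin A (Set.range ((↑) : t → L))) (S := L)
    (fun r => MvPolynomial.aeval ((↑) : t → L) (MvPolynomial.pderiv i (ht.1.repr r)))
    (fun a b => by simp)
    (fun a b => by
      have h (c) : MvPolynomial.aeval ((↑) : t → L) (ht.1.repr c) =
        algebraMap (Algebra.adjoin A (Set.range ((↑) : t → L))) L c := ht.1.aeval_repr c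
      simp [Derivation.leibniz, h])
  refine ⟨d, fun a => ?_, ?_⟩
  · have := hd (algebraMap A _ a)
    rw [AlgHom.commutes] at this
    simpa [← IsScalarTower.algebraMap_apply] using this
  · have := hd ⟨x, Algebra.subset_adjoin ⟨i, rfl⟩⟩
    have hX : ht.1.repr ⟨x, Algebra.subset_adjoin ⟨i, rfl⟩⟩ = MvPolynomial.X i := by
      apply ht.1
      rw [ht.1.aeval_repr]; simp [i]
    rw [hX] at this
    change d x = _ at this
    rw [this]; simp

lemma Der.map_aeval {A L : Type*} [CommRing A] [CommRing L] [Algebra A L] (d : Der L)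
    (hd : ∀ a, d (algebraMap A L a) = 0) (x : L) (p : A[X]) :
    d (aeval x p) = aeval x (derivative p) * d x := by
  induction p using Polynomial.induction_on' with
  | add p q hp hq => simp [hp, hq, add_mul]
  | monomial n a => simp [hd, Der.map_pow, derivative_monomial]; ring

lemma Der.isAlgebraic_iff {A L : Type*} [CommRing A] [IsDomain A] [Field L]
    [CharZero L] [Algebra A L] [FaithfulSMul A L] {x : L} :
    IsAlgebraic A x ↔ ∀ d : Der L, (∀ a, d (algebraMap A L a) = 0) → d x = 0 := by
  constructor
  · intro h d hd
    let := FractionRing.liftAlgebra A L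
    have hx : IsAlgebraic (FractionRing A) x :=
      (IsFractionRing.isAlgebraic_iff A (FractionRing A) L).mp h
    have : CharZero (FractionRing A) :=
      (algebraMap (FractionRing A) L).charZero
    have hd' (a : FractionRing A) : d (algebraMap (FractionRing A) L a) = 0 := by
      obtain ⟨b, c, hc, rfl⟩ := IsFractionRing.div_surjective (A := A) a
      have hc' : algebraMap A L c ≠ 0 := by
        simpa using nonZeroDivisors.ne_zero hc
      rw [map_div₀, ← IsScalarTower.algebraMap_apply, ← IsScalarTower.algebraMap_apply, div_eq_mul_inv,
        d.leibniz, d.mul_map_inv hc', hd, hd]; simp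
    have hsep := (minpoly.irreducible hx.isIntegral).separable
    have := d.map_aeval hd' x (minpoly (FractionRing A) x)
    rw [minpoly.aeval, _root_.map_zero, eq_comm] at this
    exact (mul_eq_zero.mp this).resolve_left
      (hsep.aeval_derivative_ne_zero (minpoly.aeval _ _))
  · intro h
    by_contra hx
    obtain ⟨d, hd, hdx⟩ := exists_ne_zero_of_transcendental hx
    exact hdx (h d hd)

end AlgebraicityViaDerivations

section Dichotomy

namespace PainleveData

variable {k E : Type*} [Field k] [CharZero k] (P : PainleveData k) [Field E]

/-- A differential point of the Painlevé vector field whose first coordinate is transcendental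
is generic. -/
lemma injective_of_injective_comp_C (φ : k[X][X] →+* E) (D : Der E)
    (hD : ∀ p, D (φ p) = φ (P.der p)) (hφ : Function.Injective (φ.comp C)) :
    Function.Injective φ := by
  rw [RingHom.injective_iff_ker_eq_bot]
  by_contra hker
  have hprime : (RingHom.ker φ).IsPrime := RingHom.ker_isPrime φ
  obtain ⟨p, hp, hpp⟩ := hprime.exists_mem_prime_of_ne_bot hker
  rw [RingHom.mem_ker] at hp
  have hdeg : p.natDegree ≠ 0 := fun h => by
    rw [eq_C_of_natDegree_eq_zero h] at hp
    have := hφ (hp.trans (φ.comp C).map_zero.symm)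
    rw [eq_C_of_natDegree_eq_zero h, this, C_0] at hpp
    exact hpp.ne_zero rfl
  have hprim := hpp.irreducible.isPrimitive hdeg
  let F := FractionRing k[X]
  let χ : F →+* E := IsFractionRing.lift hφ
  have hχ (q : k[X][X]) : (q.map (algebraMap k[X] F)).eval₂ χ (φ X) = φ q := by
    have : (eval₂RingHom χ (φ X)).comp (mapRingHom (algebraMap k[X] F)) = φ := by
      apply ringHom_ext
      · intro a
        simp [χ, IsFractionRing.lift_algebraMap]
      · simp
    exact DFunLike.congr_fun this q
  have hirr := (hprim.irreducible_iff_irreducible_map_fraction_map (K := F)).mp hpp.irreducible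
  have hdvd : p ∣ P.der p := by
    apply hprim.dvd_of_fraction_map_dvd_fraction_map (K := F)
    by_contra hnd
    obtain ⟨a, b, hab⟩ := (hirr.coprime_iff_not_dvd).mpr hnd
    have := congrArg (eval₂ χ (φ X)) hab
    rw [eval₂_add, eval₂_mul, eval₂_mul, hχ, hχ, ← hD, hp, map_zero] at this
    simp at this
  obtain ⟨c, rfl⟩ := P.exists_eq_C_C_of_dvd_der hpp.ne_zero hdvd
  simp at hdeg

end PainleveData

end Dichotomy

section DerivationClosure

namespace Der

section Operations

variable {R : Type*} [CommRing R]

instance : Add (Der R) where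
  add d e := ⟨d.toAddMonoidHom + e.toAddMonoidHom, fun a b => by
    change d (a * b) + e (a * b) = a * (d b + e b) + b * (d a + e a)
    simp only [leibniz]; ring⟩

instance : SMul R (Der R) where
  smul c d := ⟨(AddMonoidHom.mulLeft c).comp d.toAddMonoidHom, fun a b => by
    change c * d (a * b) = a * (c * d b) + b * (c * d a)
    simp only [leibniz]; ring⟩

instance : Bracket (Der R) (Der R) where
  bracket d e := ⟨d.toAddMonoidHom.comp e.toAddMonoidHom - e.toAddMonoidHom.comp d.toAddMonoidHom,
    fun a b => by
    change d (e (a * b)) - e (d (a * b)) = a * (d (e b) - e (d b)) + b * (d (e a) - e (d a))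
    simp only [leibniz, map_add]; ring⟩

@[simp] lemma add_apply (d e : Der R) (a : R) : (d + e) a = d a + e a := rfl
@[simp] lemma smul_apply (c : R) (d : Der R) (a : R) : (c • d) a = c * d a := rfl
@[simp] lemma bracket_apply (d e : Der R) (a : R) : ⁅d, e⁆ a = d (e a) - e (d a) := rfl

end Operations

variable {L M : Type*} [Field L] [Field M]

/-- The subfield of all elements killed by the derivations that kill `S`. In characteristic zero
this is the relative algebraic closure of the subfield generated by `S`. -/
def closure (S : Set L) : Subfield L where
  carrier := {x | ∀ d : Der L, (∀ a ∈ S, d a = 0) → d x = 0}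
  mul_mem' ha hb d hd := by rw [d.leibniz, ha d hd, hb d hd]; simp
  one_mem' d _ := d.map_one
  add_mem' ha hb d hd := by rw [map_add, ha d hd, hb d hd, add_zero]
  zero_mem' d _ := map_zero d
  neg_mem' ha d hd := by rw [map_neg, ha d hd, neg_zero]
  inv_mem' a ha d hd := by
    rcases eq_or_ne a 0 with rfl | h0
    · simp
    · rw [d.mul_map_inv h0, ha d hd]; simp

variable {S T : Set L} {x : L}

lemma mem_closure : x ∈ closure S ↔ ∀ d : Der L, (∀ a ∈ S, d a = 0) → d x = 0 := Iff.rfl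

lemma notMem_closure : x ∉ closure S ↔ ∃ d : Der L, (∀ a ∈ S, d a = 0) ∧ d x ≠ 0 := by
  simp [mem_closure]

lemma subset_closure : S ⊆ closure S := fun _ ha _ hd => hd _ ha

lemma closure_le (h : S ⊆ closure T) : closure S ≤ closure T :=
  fun _ hx d hd => hx d fun _ ha => h ha d hd

lemma closure_mono (h : S ⊆ T) : closure S ≤ closure T := closure_le (h.trans subset_closure)

lemma map_mem_closure_of_subset (D : Der L) (hST : S ⊆ T) (hD : ∀ a ∈ S, D a ∈ closure T)
    (hx : x ∈ closure S) : D x ∈ closure T := by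
  intro d hd
  have h₁ := hx d fun a ha => hd a (hST ha)
  have h₂ := hx ⁅d, D⁆ fun a ha => by simp [hD a ha d hd, hd a (hST ha)]
  simpa [h₁] using h₂

lemma map_mem_closure (D : Der L) (hD : ∀ a ∈ S, D a ∈ closure S)
    (hx : x ∈ closure S) : D x ∈ closure S :=
  D.map_mem_closure_of_subset subset_rfl hD hx

lemma mem_closure_map (f : L →+* M) (hx : x ∈ closure S) : f x ∈ closure (f '' S) := by
  intro d hd
  let _ := f.toAlgebra
  rw [← Module.forall_dual_apply_eq_zero_iff L]
  intro φ
  exact hx ⟨φ.toAddMonoidHom.comp (d.toAddMonoidHom.comp f.toAddMonoidHom), fun a b => by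
    change φ (d (f (a * b))) = a * φ (d (f b)) + b * φ (d (f a))
    rw [map_mul, leibniz, map_add]
    exact congr_arg₂ (· + ·) (φ.map_smul a (d (f b))) (φ.map_smul b (d (f a)))⟩
    fun a ha => by
      change φ (d (f a)) = 0
      rw [hd _ ⟨a, ha, rfl⟩, map_zero]

end Der

end DerivationClosure

section GenericSolutions

namespace PainleveData

variable {L : Type*} [Field L] (P : PainleveData L)

/-- A solution of the symmetric Painlevé system. -/
structure IsSolution (y z : L) : Prop where
  d_fst : P.d y = y * y + 2 * y * z - P.s * y + P.a₁
  d_snd : P.d z = P.s * z + P.a₂ - 2 * y * z - z * z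

/-- A differential subfield containing the coefficients of the system and closed under
algebraic elements. -/
structure IsGround (E : Subfield L) : Prop where
  map_mem : ∀ a ∈ E, P.d a ∈ E
  s_mem : P.s ∈ E
  a₁_mem : P.a₁ ∈ E
  a₂_mem : P.a₂ ∈ E
  closure_le : Der.closure (E : Set L) ≤ E

lemma isGround_closure {S : Set L} (hS : ∀ a ∈ S, P.d a ∈ Der.closure S)
    (hs : P.s ∈ Der.closure S) (h₁ : P.a₁ ∈ Der.closure S) (h₂ : P.a₂ ∈ Der.closure S) :
    P.IsGround (Der.closure S) :=
  ⟨fun _ => P.d.map_mem_closure hS, hs, h₁, h₂, Der.closure_le subset_rfl⟩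

variable {P} {E : Subfield L}

/-- Restriction of the Painlevé data to a ground field. -/
noncomputable def IsGround.data (hE : P.IsGround E) : PainleveData E where
  d := P.d.restrict E.subtype Subtype.val_injective fun a => ⟨⟨_, hE.map_mem a a.2⟩, rfl⟩
  s := ⟨P.s, hE.s_mem⟩
  a₁ := ⟨P.a₁, hE.a₁_mem⟩
  a₂ := ⟨P.a₂, hE.a₂_mem⟩
  d_s := Subtype.val_injective <| (Der.map_restrict E.subtype _ _ _ _).trans <| by
    simp [P.d_s, show ((2 : E) : L) = 2 from rfl]
  d_a₁ := Subtype.val_injective <| (Der.map_restrict E.subtype _ _ _ _).trans <| by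
    simp [P.d_a₁]
  d_a₂ := Subtype.val_injective <| (Der.map_restrict E.subtype _ _ _ _).trans <| by
    simp [P.d_a₂]
  generic a b e h := P.generic a b e <| by
    simpa [show ((2 : E) : L) = 2 from rfl] using congrArg Subtype.val h

lemma IsGround.coe_data_d (hE : P.IsGround E) (a : E) : (hE.data.d a : L) = P.d a :=
  Der.map_restrict E.subtype Subtype.val_injective _ _ _

/-- Evaluation of bivariate polynomials at a point. -/
noncomputable def evalHom (E : Subfield L) (y z : L) : E[X][X] →+* L :=
  eval₂RingHom (eval₂RingHom E.subtype y) z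

@[simp] lemma evalHom_C (y z : L) (p : E[X]) : evalHom E y z (C p) = p.eval₂ E.subtype y := by
  simp [evalHom]

@[simp] lemma evalHom_X (y z : L) : evalHom E y z X = z := by simp [evalHom]

variable {y z : L}

lemma IsSolution.map_evalHom (h : P.IsSolution y z) (hE : P.IsGround E) (p : E[X][X]) :
    P.d (evalHom E y z p) = evalHom E y z (hE.data.der p) := by
  apply leibniz_ext (evalHom E y z) (fun p => P.d (evalHom E y z p))
    (fun p => evalHom E y z (hE.data.der p))
  · simp
  · simp
  · simp
  · simp
  · apply leibniz_ext ((evalHom E y z).comp C) (fun p => P.d (evalHom E y z (C p)))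
      (fun p => evalHom E y z (hE.data.der (C p)))
    · simp
    · simp
    · simp
    · simp
    · simp [hE.coe_data_d]
    · simp [field₁, h.d_fst, IsGround.data, map_ofNat (evalHom E y z) 2]
  · simp [field₂, h.d_snd, IsGround.data, map_ofNat (evalHom E y z) 2]

variable [CharZero L]

lemma eval₂_injective (hE : Der.closure (E : Set L) ≤ E) (hy : y ∉ E) :
    Function.Injective (eval₂RingHom E.subtype y) := by
  rw [injective_iff_map_eq_zero]
  intro p hp
  by_contra h0
  refine hy (hE fun d hd => ?_)
  exact Der.isAlgebraic_iff.mp ⟨p, h0, hp⟩ d fun a => hd a a.2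

lemma IsSolution.injective_evalHom (h : P.IsSolution y z) (hE : P.IsGround E) (hy : y ∉ E) :
    Function.Injective (evalHom E y z) := by
  apply hE.data.injective_of_injective_comp_C _ P.d (h.map_evalHom hE)
  intro p q hpq
  exact eval₂_injective hE.closure_le hy (by simpa using hpq)

lemma IsSolution.snd_notMem (h : P.IsSolution y z) (hE : P.IsGround E) (hy : y ∉ E) :
    z ∉ Der.closure ((E : Set L) ∪ {y}) := by
  intro hz
  let _ : Algebra E[X] L := (eval₂RingHom E.subtype y).toAlgebra
  have : FaithfulSMul E[X] L :=
    (faithfulSMul_iff_algebraMap_injective _ _).mpr (eval₂_injective hE.closure_le hy)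
  obtain ⟨p, hp, hpz⟩ : IsAlgebraic E[X] z := Der.isAlgebraic_iff.mpr fun d hd =>
    hz d fun a ha => by
      rcases ha with ha | rfl
      · simpa [RingHom.algebraMap_toAlgebra] using hd (C ⟨a, ha⟩)
      · simpa [RingHom.algebraMap_toAlgebra] using hd X
  exact hp (h.injective_evalHom hE hy (hpz.trans (map_zero _).symm))

/-- The derivations dual to the coordinates of a generic solution. -/
lemma IsSolution.exists_dual (h : P.IsSolution y z) (hE : P.IsGround E) (hy : y ∉ E) :
    ∃ d₁ d₂ : Der L, (∀ a ∈ E, d₁ a = 0) ∧ (∀ a ∈ E, d₂ a = 0) ∧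
      d₁ y = 1 ∧ d₁ z = 0 ∧ d₂ y = 0 ∧ d₂ z = 1 := by
  obtain ⟨e, he, hey⟩ := Der.notMem_closure.mp fun hc => hy (hE.closure_le hc)
  obtain ⟨f, hf, hfz⟩ := Der.notMem_closure.mp (h.snd_notMem hE hy)
  have hfy : f y = 0 := hf y (.inr rfl)
  have hfE (a) (ha : a ∈ E) : f a = 0 := hf a (.inl ha)
  refine ⟨(e y)⁻¹ • e + (-((e y)⁻¹ * e z * (f z)⁻¹)) • f, (f z)⁻¹ • f, fun a ha => ?_,
    fun a ha => ?_, ?_, ?_, ?_, ?_⟩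
  · simp [he a ha, hfE a ha]
  · simp [hfE a ha]
  · simp [hfy, hey]
  · simp [hfz]
  · simp [hfy]
  · simp [hfz]

end PainleveData

end GenericSolutions

section Triples

namespace PainleveData

variable {L : Type*} [Field L] {P : PainleveData L}

section Linearization

variable {y z : L}

lemma IsSolution.map_d_fst (h : P.IsSolution y z) {e : Der L} (hs : e P.s = 0) (h₁ : e P.a₁ = 0) :
    e (P.d y) = (2 * y + 2 * z - P.s) * e y + 2 * y * e z := by
  simp [h.d_fst, hs, h₁]; ring

lemma IsSolution.map_d_snd (h : P.IsSolution y z) {e : Der L} (hs : e P.s = 0) (h₂ : e P.a₂ = 0) :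
    e (P.d z) = -(2 * z) * e y - (2 * y + 2 * z - P.s) * e z := by
  simp [h.d_snd, hs, h₂]; ring

end Linearization

/-- Extension of a derivation to the rational function field in one variable, with prescribed
value at the variable. -/
lemma _root_.Der.exists_extension_fractionRing (d : Der L) (W : L[X]) :
    ∃ e : Der (FractionRing L[X]), (∀ a, e (algebraMap L[X] (FractionRing L[X]) (C a))
        = algebraMap L[X] (FractionRing L[X]) (C (d a))) ∧
      e (algebraMap L[X] (FractionRing L[X]) X) = algebraMap L[X] (FractionRing L[X]) W := by
  have : Algebra.FormallySmooth L[X] (FractionRing L[X]) := .of_isLocalization (nonZeroDivisors _)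
  obtain ⟨e, he⟩ := Der.exists_extension (R := L[X]) (S := FractionRing L[X])
    (fun p => algebraMap _ _ (coeffDer d p + W * derivative p)) (fun a b => by simp; ring)
    (fun a b => by simp; ring)
  exact ⟨e, fun a => by simp [he], by simp [he]⟩

/-- Data on a field extension compatible with the given one. -/
def map {M : Type*} [Field M] (P : PainleveData L) (f : L →+* M) (e : Der M)
    (he : ∀ a, e (f a) = f (P.d a)) : PainleveData M where
  d := e
  s := f P.s
  a₁ := f P.a₁
  a₂ := f P.a₂
  d_s := by simp [he, P.d_s, map_ofNat f 2]
  d_a₁ := by simp [he, P.d_a₁]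
  d_a₂ := by simp [he, P.d_a₂]
  generic a b c h := P.generic a b c <| f.injective <| by
    simpa [map_ofNat f 2] using h

/-- The exchange property for pairs of algebraically independent elements. -/
lemma mem_closure_of_dual {S : Set L} {p₁ p₂ r₁ r₂ : L}
    (h₁ : r₁ ∈ Der.closure (S ∪ {p₁, p₂})) (h₂ : r₂ ∈ Der.closure (S ∪ {p₁, p₂}))
    {e₁ e₂ : Der L} (he₁ : ∀ a ∈ S, e₁ a = 0) (he₂ : ∀ a ∈ S, e₂ a = 0)
    (h₁₁ : e₁ r₁ = 1) (h₁₂ : e₁ r₂ = 0) (h₂₁ : e₂ r₁ = 0) (h₂₂ : e₂ r₂ = 1) :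
    p₁ ∈ Der.closure (S ∪ {r₁, r₂}) ∧ p₂ ∈ Der.closure (S ∪ {r₁, r₂}) := by
  have key (d : Der L) (hd : ∀ a ∈ S ∪ {r₁, r₂}, d a = 0) : d p₁ = 0 ∧ d p₂ = 0 := by
    have hr₁ : d r₁ = 0 := hd r₁ (by simp)
    have hr₂ : d r₂ = 0 := hd r₂ (by simp)
    have aux (a b c : L) (hp₁ : a * d p₁ + b * e₁ p₁ + c * e₂ p₁ = 0)
        (hp₂ : a * d p₂ + b * e₁ p₂ + c * e₂ p₂ = 0) : b = 0 ∧ c = 0 := by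
      have hz : ∀ x ∈ S ∪ {p₁, p₂}, (a • d + b • e₁ + c • e₂) x = 0 := by
        rintro x (hx | rfl | rfl)
        · simp [hd x (.inl hx), he₁ x hx, he₂ x hx]
        · simpa using hp₁
        · simpa using hp₂
      exact ⟨by simpa [hr₁, h₁₁, h₂₁] using h₁ _ hz, by simpa [hr₂, h₁₂, h₂₂] using h₂ _ hz⟩
    have hdet : e₁ p₁ * e₂ p₂ - e₁ p₂ * e₂ p₁ ≠ 0 := by
      intro hdet
      have t₁ := aux 0 (e₂ p₁) (-e₁ p₁) (by ring) (by linear_combination -hdet)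
      have t₂ := aux 0 (e₂ p₂) (-e₁ p₂) (by linear_combination hdet) (by ring)
      have t₃ := aux 0 1 0 (by simpa using t₁.2) (by simpa using t₂.2)
      exact one_ne_zero t₃.1
    have t := aux (e₁ p₁ * e₂ p₂ - e₁ p₂ * e₂ p₁) (d p₂ * e₂ p₁ - d p₁ * e₂ p₂)
      (d p₁ * e₁ p₂ - d p₂ * e₁ p₁) (by ring) (by ring)
    have s₁ : (e₁ p₁ * e₂ p₂ - e₁ p₂ * e₂ p₁) * d p₁ = 0 := by
      linear_combination (-e₁ p₁) * t.1 - e₂ p₁ * t.2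
    have s₂ : (e₁ p₁ * e₂ p₂ - e₁ p₂ * e₂ p₁) * d p₂ = 0 := by
      linear_combination (-e₁ p₂) * t.1 - e₂ p₂ * t.2
    exact ⟨(mul_eq_zero.mp s₁).resolve_left hdet, (mul_eq_zero.mp s₂).resolve_left hdet⟩
  exact ⟨fun d hd => (key d hd).1, fun d hd => (key d hd).2⟩

/-- The derivatives of a solution with respect to parameters. -/
lemma IsSolution.d_map_of_dual {E : Subfield L} (hE : P.IsGround E) {q₁ q₂ r₁ r₂ : L}
    (hq : P.IsSolution q₁ q₂) (hr : P.IsSolution r₁ r₂)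
    (hr₁ : r₁ ∈ Der.closure ((E : Set L) ∪ {q₁, q₂}))
    (hr₂ : r₂ ∈ Der.closure ((E : Set L) ∪ {q₁, q₂}))
    {e₁ e₂ : Der L} (he₁ : ∀ a ∈ E, e₁ a = 0) (he₂ : ∀ a ∈ E, e₂ a = 0)
    (h₁₁ : e₁ q₁ = 1) (h₁₂ : e₁ q₂ = 0) (h₂₁ : e₂ q₁ = 0) (h₂₂ : e₂ q₂ = 1)
    {e : Der L} (he : ∀ a ∈ E, e a = 0) (hc₁ : P.d (e q₁) = 0) (hc₂ : P.d (e q₂) = 0) :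
    P.d (e r₁) = (2 * r₁ + 2 * r₂ - P.s) * e r₁ + 2 * r₁ * e r₂
      - e₁ r₁ * ((2 * q₁ + 2 * q₂ - P.s) * e q₁ + 2 * q₁ * e q₂)
      - e₂ r₁ * (-(2 * q₂) * e q₁ - (2 * q₁ + 2 * q₂ - P.s) * e q₂) ∧
    P.d (e r₂) = -(2 * r₂) * e r₁ - (2 * r₁ + 2 * r₂ - P.s) * e r₂
      - e₁ r₂ * ((2 * q₁ + 2 * q₂ - P.s) * e q₁ + 2 * q₁ * e q₂)
      - e₂ r₂ * (-(2 * q₂) * e q₁ - (2 * q₁ + 2 * q₂ - P.s) * e q₂) := by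
  have hs := he _ hE.s_mem
  have ha₁ := he _ hE.a₁_mem
  have ha₂ := he _ hE.a₂_mem
  have hz : ∀ x ∈ (E : Set L) ∪ {q₁, q₂}, (⁅P.d, e⁆
      + ((2 * q₁ + 2 * q₂ - P.s) * e q₁ + 2 * q₁ * e q₂) • e₁
      + (-(2 * q₂) * e q₁ - (2 * q₁ + 2 * q₂ - P.s) * e q₂) • e₂) x = 0 := by
    rintro x (hx | rfl | rfl)
    · simp [he x hx, he₁ x hx, he₂ x hx, he _ (hE.map_mem x hx)]
    · simp [hc₁, h₁₁, h₂₁, hq.map_d_fst hs ha₁]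
    · simp [hc₂, h₁₂, h₂₂, hq.map_d_snd hs ha₂]; ring
  have t₁ := hr₁ _ hz
  have t₂ := hr₂ _ hz
  simp only [Der.add_apply, Der.smul_apply, Der.bracket_apply, hr.map_d_fst hs ha₁,
    hr.map_d_snd hs ha₂] at t₁ t₂
  exact ⟨by linear_combination t₁, by linear_combination t₂⟩

variable [CharZero L]

/-- Two vectors along a solution satisfying the conjugated linear system and algebraic over
that solution vanish. -/
lemma matrix_system_eq_zero {E : Subfield L} (hE : P.IsGround E) {q₁ q₂ r₁ r₂ : L}
    (hq₁ : q₁ ∈ E) (hq₂ : q₂ ∈ E) (hr : P.IsSolution r₁ r₂) (hr₁ : r₁ ∉ E)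
    {n₁₁ n₁₂ n₂₁ n₂₂ : L}
    (h₁₁ : P.d n₁₁ = (2 * r₁ + 2 * r₂ - P.s) * n₁₁ + 2 * r₁ * n₂₁
      - n₁₁ * (2 * q₁ + 2 * q₂ - P.s) + n₁₂ * (2 * q₂))
    (h₁₂ : P.d n₁₂ = (2 * r₁ + 2 * r₂ - P.s) * n₁₂ + 2 * r₁ * n₂₂
      - n₁₁ * (2 * q₁) + n₁₂ * (2 * q₁ + 2 * q₂ - P.s))
    (h₂₁ : P.d n₂₁ = -(2 * r₂) * n₁₁ - (2 * r₁ + 2 * r₂ - P.s) * n₂₁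
      - n₂₁ * (2 * q₁ + 2 * q₂ - P.s) + n₂₂ * (2 * q₂))
    (h₂₂ : P.d n₂₂ = -(2 * r₂) * n₁₂ - (2 * r₁ + 2 * r₂ - P.s) * n₂₂
      - n₂₁ * (2 * q₁) + n₂₂ * (2 * q₁ + 2 * q₂ - P.s))
    (hn₁₁ : n₁₁ ∈ Der.closure ((E : Set L) ∪ {r₁, r₂}))
    (hn₁₂ : n₁₂ ∈ Der.closure ((E : Set L) ∪ {r₁, r₂}))
    (hn₂₁ : n₂₁ ∈ Der.closure ((E : Set L) ∪ {r₁, r₂}))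
    (hn₂₂ : n₂₂ ∈ Der.closure ((E : Set L) ∪ {r₁, r₂})) :
    n₁₁ = 0 ∧ n₁₂ = 0 ∧ n₂₁ = 0 ∧ n₂₂ = 0 := by
  let M := FractionRing L[X]
  let ι : L →+* M := (algebraMap L[X] M).comp C
  let w : M := algebraMap L[X] M X
  have : CharZero M := charZero_of_injective_ringHom ι.injective
  obtain ⟨e, he, hew⟩ := P.d.exists_extension_fractionRing
    (C (2 * q₁) + C (2 * (2 * q₁ + 2 * q₂ - P.s)) * X + C (2 * q₂) * X ^ 2)
  change ∀ a, e (ι a) = ι (P.d a) at he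
  replace hew : e w = ι (2 * q₁) + ι (2 * (2 * q₁ + 2 * q₂ - P.s)) * w + ι (2 * q₂) * w ^ 2 := by
    simpa [ι, w] using hew
  let Q : PainleveData M := P.map ι e he
  let S : Set M := ι '' E ∪ {w}
  have hιS (a : L) (ha : a ∈ E) : ι a ∈ Der.closure S :=
    Der.subset_closure (.inl ⟨a, ha, rfl⟩)
  have hwS : w ∈ Der.closure S := Der.subset_closure (.inr rfl)
  have h2 : (2 : L) ∈ E := ofNat_mem E 2
  have hB : 2 * q₁ + 2 * q₂ - P.s ∈ E :=
    sub_mem (add_mem (mul_mem h2 hq₁) (mul_mem h2 hq₂)) hE.s_mem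
  have hk : Q.IsGround (Der.closure S) := by
    refine Q.isGround_closure ?_ (hιS _ hE.s_mem) (hιS _ hE.a₁_mem) (hιS _ hE.a₂_mem)
    rintro _ (⟨a, ha, rfl⟩ | rfl)
    · change e (ι a) ∈ _
      rw [he]
      exact hιS _ (hE.map_mem a ha)
    · change e w ∈ _
      rw [hew]
      exact add_mem (add_mem (hιS _ (mul_mem h2 hq₁)) (mul_mem (hιS _ (mul_mem h2 hB)) hwS))
        (mul_mem (hιS _ (mul_mem h2 hq₂)) (pow_mem hwS 2))
  have hrk : ι r₁ ∉ Der.closure S := by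
    obtain ⟨f, hf, hfr⟩ := Der.notMem_closure.mp fun hc => hr₁ (hE.closure_le hc)
    obtain ⟨g, hg, hgw⟩ := f.exists_extension_fractionRing 0
    refine Der.notMem_closure.mpr ⟨g, ?_, ?_⟩
    · rintro _ (⟨a, ha, rfl⟩ | rfl)
      · exact (hg a).trans (by simp [hf a ha])
      · exact hgw.trans (by simp)
    · exact fun h => hfr (ι.injective ((hg r₁).symm.trans (h.trans ι.map_zero.symm)))
  have hrQ : Q.IsSolution (ι r₁) (ι r₂) := by
    constructor
    · change e (ι r₁) = _
      rw [he, hr.d_fst]; simp [Q, map, map_ofNat ι 2]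
    · change e (ι r₂) = _
      rw [he, hr.d_snd]; simp [Q, map, map_ofNat ι 2]
  let k := Der.closure S
  let _ : Algebra k[X][X] M := (evalHom k (ι r₁) (ι r₂)).toAlgebra
  have hinj : Function.Injective (algebraMap k[X][X] M) := hrQ.injective_evalHom hk hrk
  have : FaithfulSMul k[X][X] M := (faithfulSMul_iff_algebraMap_injective _ _).mpr hinj
  have hX : algebraMap k[X][X] M X = ι r₂ := evalHom_X _ _
  have hCX : algebraMap k[X][X] M (C X) = ι r₁ := (evalHom_C _ _ _).trans (by simp)
  have hCC (a : k) : algebraMap k[X][X] M (C (C a)) = a := (evalHom_C _ _ _).trans (by simp)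
  have hlin : algebraMap k[X][X] M hk.data.lin₁₁ = 2 * ι r₁ + 2 * ι r₂ - ι P.s := by
    rw [lin₁₁, map_sub, map_add, map_mul, map_mul, hX, hCX, hCC, map_ofNat]; rfl
  let μ : k := ⟨-(w * ι (2 * q₂)) - ι (2 * q₁ + 2 * q₂ - P.s),
    sub_mem (neg_mem (mul_mem hwS (hιS _ (mul_mem h2 hq₂)))) (hιS _ hB)⟩
  have halg {n n' : L} (hn : n ∈ Der.closure ((E : Set L) ∪ {r₁, r₂}))
      (hn' : n' ∈ Der.closure ((E : Set L) ∪ {r₁, r₂})) :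
      IsAlgebraic k[X][X] (w * ι n + ι n') := by
    refine Der.isAlgebraic_iff.mpr fun d hd => ?_
    have hdk (a : M) (ha : a ∈ k) : d a = 0 := by
      simpa [hCC] using hd (C (C ⟨a, ha⟩))
    have hd0 : ∀ a ∈ ι '' ((E : Set L) ∪ {r₁, r₂}), d a = 0 := by
      rintro _ ⟨a, ha | rfl | rfl, rfl⟩
      · exact hdk _ (hιS a ha)
      · rw [← hCX, hd]
      · rw [← hX, hd]
    simp [hdk w hwS, Der.mem_closure_map ι hn d hd0, Der.mem_closure_map ι hn' d hd0]
  have key := hk.data.linear_system_eq_zero hinj e (hrQ.map_evalHom hk) (μ := μ)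
    (v₁ := w * ι n₁₁ + ι n₁₂) (v₂ := w * ι n₂₁ + ι n₂₂)
    (by
      rw [hlin, hCC, map_mul, hCX, map_ofNat]
      simp only [map_add, Der.leibniz, he, hew, h₁₁, h₁₂, μ, map_sub, map_mul, map_ofNat]
      ring)
    (by
      rw [map_neg _ hk.data.lin₁₁, map_neg, hlin, hCC, map_mul, hX, map_ofNat]
      simp only [map_add, Der.leibniz, he, hew, h₂₁, h₂₂, μ, map_sub, map_mul, map_ofNat, map_neg]
      ring)
    (halg hn₁₁ hn₁₂) (halg hn₂₁ hn₂₂)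
  have hzero {n n' : L} (h : w * ι n + ι n' = 0) : n = 0 ∧ n' = 0 := by
    have : X * C n + C n' = (0 : L[X]) :=
      IsFractionRing.injective L[X] M (by rw [map_add, map_mul, map_zero]; exact h)
    exact ⟨by simpa using congrArg (coeff · 1) this, by simpa using congrArg (coeff · 0) this⟩
  exact ⟨(hzero key.1).1, (hzero key.1).2, (hzero key.2).1, (hzero key.2).2⟩

/-- Three pairwise independent solutions are independent. -/
theorem IsSolution.false_of_triple {E F : Subfield L} (hE : P.IsGround E) (hF : P.IsGround F)
    {p₁ p₂ q₁ q₂ r₁ r₂ : L} (hq : P.IsSolution q₁ q₂)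
    (hr : P.IsSolution r₁ r₂)
    (hqF₁ : q₁ ∈ F) (hqF₂ : q₂ ∈ F) (hqE : q₁ ∉ E) (hrE : r₁ ∉ E) (hrF : r₁ ∉ F)
    (hEF : Der.closure ((E : Set L) ∪ {q₁, q₂}) ≤ Der.closure ((F : Set L) ∪ {p₁, p₂}))
    (hr₁ : r₁ ∈ Der.closure ((E : Set L) ∪ {q₁, q₂}))
    (hr₂ : r₂ ∈ Der.closure ((E : Set L) ∪ {q₁, q₂})) : False := by
  obtain ⟨f₁, f₂, hf₁, hf₂, hf₁₁, hf₁₂, hf₂₁, hf₂₂⟩ := hr.exists_dual hF hrF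
  obtain ⟨hp₁, hp₂⟩ := mem_closure_of_dual (hEF hr₁) (hEF hr₂) hf₁ hf₂ hf₁₁ hf₁₂ hf₂₁ hf₂₂
  have hFr : Der.closure ((E : Set L) ∪ {q₁, q₂}) ≤ Der.closure ((F : Set L) ∪ {r₁, r₂}) :=
    hEF.trans <| Der.closure_le <| by
      rintro x (hx | rfl | rfl)
      exacts [Der.subset_closure (.inl hx), hp₁, hp₂]
  obtain ⟨e₁, e₂, he₁, he₂, h₁₁, h₁₂, h₂₁, h₂₂⟩ := hq.exists_dual hE hqE
  have hd {e : Der L} (he : ∀ a ∈ E, e a = 0) (hc₁ : P.d (e q₁) = 0) (hc₂ : P.d (e q₂) = 0) :=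
    hq.d_map_of_dual hE hr hr₁ hr₂ he₁ he₂ h₁₁ h₁₂ h₂₁ h₂₂ he hc₁ hc₂
  have hd₁ := hd he₁ (by simp [h₁₁]) (by simp [h₁₂])
  have hd₂ := hd he₂ (by simp [h₂₁]) (by simp [h₂₂])
  rw [h₁₁, h₁₂] at hd₁
  rw [h₂₁, h₂₂] at hd₂
  have hmem {e : Der L} (he : ∀ a ∈ E, e a = 0) (hc₁ : e q₁ = 0 ∨ e q₁ = 1)
      (hc₂ : e q₂ = 0 ∨ e q₂ = 1) {x : L} (hx : x ∈ Der.closure ((E : Set L) ∪ {q₁, q₂})) :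
      e x ∈ Der.closure ((F : Set L) ∪ {r₁, r₂}) := by
    have h01 {a : L} (ha : a = 0 ∨ a = 1) : a ∈ Der.closure ((E : Set L) ∪ {q₁, q₂}) := by
      rcases ha with rfl | rfl
      exacts [zero_mem _, one_mem _]
    refine hFr (e.map_mem_closure ?_ hx)
    rintro a (ha | rfl | rfl)
    exacts [h01 (.inl (he a ha)), h01 hc₁, h01 hc₂]
  obtain ⟨n₁₁, n₁₂, n₂₁, n₂₂⟩ := matrix_system_eq_zero hF hqF₁ hqF₂ hr hrF
    (n₁₁ := e₁ r₁) (n₁₂ := e₂ r₁) (n₂₁ := e₁ r₂) (n₂₂ := e₂ r₂)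
    (by linear_combination hd₁.1) (by linear_combination hd₂.1)
    (by linear_combination hd₁.2) (by linear_combination hd₂.2)
    (hmem he₁ (.inr h₁₁) (.inl h₁₂) hr₁) (hmem he₂ (.inl h₂₁) (.inr h₂₂) hr₁)
    (hmem he₁ (.inr h₁₁) (.inl h₁₂) hr₂) (hmem he₂ (.inl h₂₁) (.inr h₂₂) hr₂)
  refine hrE (hE.closure_le fun d hd => ?_)
  have := hr₁ (d + (-d q₁) • e₁ + (-d q₂) • e₂) (by
    rintro a (ha | rfl | rfl)
    · simp [hd a ha, he₁ a ha, he₂ a ha]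
    · simp [h₁₁, h₂₁]
    · simp [h₁₂, h₂₂])
  simpa [n₁₁, n₁₂] using this

end PainleveData

end Triples

section AlgebraicIndependenceViaDerivations

variable {K L ι : Type*} [Field K] [Field L] [Algebra K L]

lemma Der.map_eq_zero_of_mem_adjoin (d : Der L) (hd : ∀ a, d (algebraMap K L a) = 0) {s : Set L}
    (hs : ∀ a ∈ s, d a = 0) {x : L} (hx : x ∈ Algebra.adjoin K s) : d x = 0 := by
  induction hx using Algebra.adjoin_induction with
  | mem x hx => exact hs x hx
  | algebraMap r => exact hd r
  | add x y _ _ hx hy => rw [map_add, hx, hy, add_zero]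
  | mul x y _ _ hx hy => rw [leibniz, hx, hy]; simp

variable [CharZero L]

lemma AlgebraicIndependent.of_derivations {x : ι → L}
    (h : ∀ i, ∃ d : Der L, (∀ a, d (algebraMap K L a) = 0) ∧ (∀ j, j ≠ i → d (x j) = 0) ∧
      d (x i) ≠ 0) : AlgebraicIndependent K x := by
  refine algebraicIndependent_of_finite_type' (algebraMap K L).injective ?_
  intro t _ _ i hi halg
  obtain ⟨d, hd, hdj, hdi⟩ := h i
  refine hdi (Der.isAlgebraic_iff.mp halg d fun a => ?_)
  refine d.map_eq_zero_of_mem_adjoin hd ?_ a.2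
  rintro _ ⟨j, hj, rfl⟩
  exact hdj j fun hji => hi (hji ▸ hj)

lemma AlgebraicIndependent.exists_derivation {x : ι → L} (h : AlgebraicIndependent K x)
    {i : ι} {s : Set ι} (hi : i ∉ s) :
    ∃ d : Der L, (∀ a, d (algebraMap K L a) = 0) ∧ (∀ j ∈ s, d (x j) = 0) ∧ d (x i) ≠ 0 := by
  obtain ⟨d, hd, hdi⟩ := Der.exists_ne_zero_of_transcendental (h.transcendental_adjoin hi)
  exact ⟨d, fun a => hd (algebraMap K _ a),
    fun j hj => hd ⟨x j, Algebra.subset_adjoin ⟨j, hj, rfl⟩⟩, hdi⟩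

end AlgebraicIndependenceViaDerivations

section Families

namespace PainleveData

variable {L ι : Type*} [Field L] {P : PainleveData L} {K : Subfield L}

lemma isGround_closure_family (hK : ∀ a ∈ K, P.d a ∈ K) (hs : P.s ∈ K) (ha₁ : P.a₁ ∈ K)
    (ha₂ : P.a₂ ∈ K) {y z : ι → L} (hyz : ∀ i, P.IsSolution (y i) (z i)) (S : Set ι) :
    P.IsGround (Der.closure ((K : Set L) ∪ (y '' S ∪ z '' S))) := by
  have hKS (a : L) (ha : a ∈ K) : a ∈ Der.closure ((K : Set L) ∪ (y '' S ∪ z '' S)) :=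
    Der.subset_closure (.inl ha)
  refine P.isGround_closure ?_ (hKS _ hs) (hKS _ ha₁) (hKS _ ha₂)
  have hS (i) (hi : i ∈ S) : y i ∈ Der.closure ((K : Set L) ∪ (y '' S ∪ z '' S)) ∧
      z i ∈ Der.closure ((K : Set L) ∪ (y '' S ∪ z '' S)) :=
    ⟨Der.subset_closure (.inr (.inl ⟨i, hi, rfl⟩)), Der.subset_closure (.inr (.inr ⟨i, hi, rfl⟩))⟩
  have h2 := ofNat_mem (Der.closure ((K : Set L) ∪ (y '' S ∪ z '' S))) 2
  rintro _ (ha | ⟨i, hi, rfl⟩ | ⟨i, hi, rfl⟩)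
  · exact hKS _ (hK _ ha)
  · obtain ⟨hy, hz⟩ := hS i hi
    rw [(hyz i).d_fst]
    exact add_mem (sub_mem (add_mem (mul_mem hy hy) (mul_mem (mul_mem h2 hy) hz))
      (mul_mem (hKS _ hs) hy)) (hKS _ ha₁)
  · obtain ⟨hy, hz⟩ := hS i hi
    rw [(hyz i).d_snd]
    exact sub_mem (sub_mem (add_mem (mul_mem (hKS _ hs) hz) (hKS _ ha₂))
      (mul_mem (mul_mem h2 hy) hz)) (mul_mem hz hz)

variable [CharZero L]

lemma IsSolution.snd_mem {y z : L} (h : P.IsSolution y z) (hy0 : y ≠ 0) {E : Subfield L}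
    (hs : P.s ∈ E) (ha₁ : P.a₁ ∈ E) (hy : y ∈ E) (hy' : P.d y ∈ E) : z ∈ E := by
  have : z = (P.d y - y * y + P.s * y - P.a₁) / (2 * y) := by
    rw [h.d_fst]; field_simp; ring
  rw [this]
  exact div_mem (sub_mem (add_mem (sub_mem hy' (mul_mem hy hy)) (mul_mem hs hy)) ha₁)
    (mul_mem (ofNat_mem E 2) hy)

/-- Pairwise independent solutions are independent. -/
theorem notMem_closure_family [DecidableEq ι] (hK : ∀ a ∈ K, P.d a ∈ K) (hs : P.s ∈ K)
    (ha₁ : P.a₁ ∈ K) (ha₂ : P.a₂ ∈ K) {y z : ι → L} (hyz : ∀ i, P.IsSolution (y i) (z i))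
    (hy0 : ∀ i, y i ≠ 0)
    (hpair : ∀ i j, i ≠ j → y i ∉ Der.closure ((K : Set L) ∪ {y j, z j}))
    (S : Finset ι) (hS : S.Nonempty) {i : ι} (hi : i ∉ S) :
    y i ∉ Der.closure ((K : Set L) ∪ (y '' S ∪ z '' S)) := by
  induction S using Finset.strongInduction generalizing i with
  | H S ih =>
    intro hmem
    obtain ⟨p, hp⟩ := hS
    by_cases hq : ∃ q ∈ S, q ≠ p
    · obtain ⟨q, hq, hqp⟩ := hq
      have hsub {q p : ι} (hq : q ∈ S) (hp : p ∈ S) (hqp : q ≠ p) {i : ι} (hi : i ∉ S.erase q) :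
          y i ∉ Der.closure ((K : Set L) ∪ (y '' (S.erase q : Finset ι)
            ∪ z '' (S.erase q : Finset ι))) :=
        ih (S.erase q) (Finset.erase_ssubset hq) ⟨p, Finset.mem_erase.mpr ⟨hqp.symm, hp⟩⟩ hi
      have hground := isGround_closure_family hK hs ha₁ ha₂ hyz
      have hle {q : ι} : Der.closure ((K : Set L) ∪ (y '' S ∪ z '' S)) ≤
          Der.closure ((Der.closure ((K : Set L) ∪ (y '' (S.erase q : Finset ι)
            ∪ z '' (S.erase q : Finset ι))) : Set L) ∪ {y q, z q}) := by
        apply Der.closure_mono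
        rintro _ (ha | ⟨j, hj, rfl⟩ | ⟨j, hj, rfl⟩)
        · exact .inl (Der.subset_closure (.inl ha))
        · by_cases hjq : j = q
          · exact .inr (by simp [hjq])
          · exact .inl (Der.subset_closure (.inr (.inl ⟨j, by simp_all, rfl⟩)))
        · by_cases hjq : j = q
          · exact .inr (by simp [hjq])
          · exact .inl (Der.subset_closure (.inr (.inr ⟨j, by simp_all, rfl⟩)))
      have hge {q : ι} (hq : q ∈ S) : Der.closure ((Der.closure ((K : Set L) ∪
          (y '' (S.erase q : Finset ι) ∪ z '' (S.erase q : Finset ι))) : Set L) ∪ {y q, z q}) ≤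
          Der.closure ((K : Set L) ∪ (y '' S ∪ z '' S)) := by
        apply Der.closure_le
        rintro x (hx | rfl | rfl)
        · refine Der.closure_mono ?_ hx
          have : ((S.erase q : Finset ι) : Set ι) ⊆ S := by simp
          gcongr
        · exact Der.subset_closure (.inr (.inl ⟨q, hq, rfl⟩))
        · exact Der.subset_closure (.inr (.inr ⟨q, hq, rfl⟩))
      have hqm : q ∈ ((S.erase p : Finset ι) : Set ι) := by simp [hq, hqp]
      have hiS := hground S
      exact IsSolution.false_of_triple (hground (S.erase q : Finset ι))
        (hground (S.erase p : Finset ι)) (hyz q) (hyz i)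
        (Der.subset_closure (.inr (.inl ⟨q, hqm, rfl⟩)))
        (Der.subset_closure (.inr (.inr ⟨q, hqm, rfl⟩)))
        (hsub hq hp hqp (by simp)) (hsub hq hp hqp (by simp [hi]))
        (hsub hp hq hqp.symm (by simp [hi])) ((hge hq).trans hle) (hle hmem)
        (hle ((hyz i).snd_mem (hy0 i) hiS.s_mem hiS.a₁_mem hmem (hiS.map_mem _ hmem)))
    · push Not at hq
      obtain rfl : S = {p} := Finset.eq_singleton_iff_unique_mem.mpr ⟨hp, hq⟩
      refine hpair i p (by simpa using hi) ?_
      rwa [Finset.coe_singleton, Set.image_singleton, Set.image_singleton,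
        Set.singleton_union] at hmem

/-- Solutions which are pairwise independent over a differential field are algebraically
independent together with their derivatives. -/
theorem algebraicIndependent_of_pairwise [Fintype ι] [DecidableEq ι] [Nontrivial ι]
    (hK : ∀ a ∈ K, P.d a ∈ K) (hs : P.s ∈ K)
    (ha₁ : P.a₁ ∈ K) (ha₂ : P.a₂ ∈ K) {y z : ι → L} (hyz : ∀ i, P.IsSolution (y i) (z i))
    (hy0 : ∀ i, y i ≠ 0)
    (hpair : ∀ i j, i ≠ j → y i ∉ Der.closure ((K : Set L) ∪ {y j, z j})) :
    AlgebraicIndependent K (Sum.elim y fun i => P.d (y i)) := by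
  have key (i : ι) : ∃ e₁ e₂ : Der L, (∀ a ∈ K, e₁ a = 0) ∧ (∀ a ∈ K, e₂ a = 0) ∧
      (∀ j, j ≠ i → e₁ (y j) = 0 ∧ e₁ (P.d (y j)) = 0 ∧ e₂ (y j) = 0 ∧ e₂ (P.d (y j)) = 0) ∧
      e₁ (y i) = 1 ∧ e₁ (z i) = 0 ∧ e₂ (y i) = 0 ∧ e₂ (z i) = 1 := by
    have hg := isGround_closure_family hK hs ha₁ ha₂ hyz (Finset.univ.erase i : Finset ι)
    obtain ⟨j, hj⟩ := exists_ne i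
    obtain ⟨e₁, e₂, he₁, he₂, h⟩ := (hyz i).exists_dual hg
      (notMem_closure_family hK hs ha₁ ha₂ hyz hy0 hpair (Finset.univ.erase i)
        ⟨j, by simpa using hj⟩ (by simp))
    refine ⟨e₁, e₂, fun a ha => he₁ _ (Der.subset_closure (.inl ha)),
      fun a ha => he₂ _ (Der.subset_closure (.inl ha)), fun j hj => ?_, h⟩
    have hyj : y j ∈ Der.closure ((K : Set L) ∪ (y '' (Finset.univ.erase i : Finset ι)
        ∪ z '' (Finset.univ.erase i : Finset ι))) :=
      Der.subset_closure (.inr (.inl ⟨j, by simpa using hj, rfl⟩))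
    exact ⟨he₁ _ hyj, he₁ _ (hg.map_mem _ hyj), he₂ _ hyj, he₂ _ (hg.map_mem _ hyj)⟩
  apply AlgebraicIndependent.of_derivations
  rintro (i | i) <;> obtain ⟨e₁, e₂, he₁, he₂, hj, h₁₁, h₁₂, h₂₁, h₂₂⟩ := key i
  · have h1 := (hyz i).map_d_fst (he₁ _ hs) (he₁ _ ha₁)
    have h2 := (hyz i).map_d_fst (he₂ _ hs) (he₂ _ ha₁)
    rw [h₁₁, h₁₂] at h1
    rw [h₂₁, h₂₂] at h2
    refine ⟨e₁ + (-(2 * y i + 2 * z i - P.s) / (2 * y i)) • e₂, fun a => ?_, ?_, ?_⟩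
    · have := he₁ a a.2
      have := he₂ a a.2
      simp_all [Subfield.algebraMap_ofSubfield]
    · rintro (j | j) hji
      · have := hj j (by simpa using hji)
        simp [this]
      · by_cases hji : j = i
        · subst hji
          have := hy0 j
          simp only [Sum.elim_inr, Der.add_apply, Der.smul_apply, h1, h2]
          field_simp
          ring
        · simp [hj j hji]
    · simp [h₁₁, h₂₁]
  · have h2 := (hyz i).map_d_fst (he₂ _ hs) (he₂ _ ha₁)
    rw [h₂₁, h₂₂] at h2
    refine ⟨e₂, fun a => he₂ a a.2, ?_, ?_⟩
    · rintro (j | j) hji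
      · by_cases hji : j = i
        · subst hji; exact h₂₁
        · exact (hj j hji).2.2.1
      · exact (hj j (by simpa using hji)).2.2.2
    · simp [h2, hy0 i]

end PainleveData

end Families

section FourthPainleve

/-- A linear relation between `1`, `c` and `α` with natural number coefficients of the shape
needed for `PainleveData` is trivial if `c ^ 2 = -2 * β`, with `α` and `β` algebraically
independent. -/
lemma eq_zero_of_algebraicIndependent {α β c : ℂ} (hind : AlgebraicIndependent ℚ ![α, β])
    (hc : c ^ 2 = -2 * β) (a b e : ℕ)
    (h : (a : ℂ) * c + b * (-α - 1 - c / 2) + e * (-2 - c - (-α - 1 - c / 2)) = 0) :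
    a = 0 ∧ b = 0 ∧ e = 0 := by
  set r : ℚ := a - b / 2 - e / 2 with hr
  set Q : MvPolynomial (Fin 2) ℚ := .C (2 * r ^ 2) * .X 1 +
    (.C ((e : ℚ) - b) * .X 0 - .C ((b : ℚ) + e)) ^ 2 with hQ
  have hQ0 : Q = 0 := by
    refine (algebraicIndependent_iff.mp hind) Q ?_
    have hrc : (r : ℂ) = a - b / 2 - e / 2 := by simp [hr]
    simp [hQ, hrc]
    linear_combination (((e : ℂ) - b) * α - (b + e) - (a - b / 2 - e / 2) * c) * h
      + (a - b / 2 - e / 2) ^ 2 * hc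
  have h00 := congrArg (MvPolynomial.eval ![0, 0]) hQ0
  have h01 := congrArg (MvPolynomial.eval ![0, 1]) hQ0
  simp only [hQ, map_add, map_sub, map_mul, map_pow, MvPolynomial.eval_C, MvPolynomial.eval_X,
    map_zero, Matrix.cons_val_zero, Matrix.cons_val_one] at h00 h01
  have hbe : (b : ℚ) + e = 0 := by
    have : ((b : ℚ) + e) ^ 2 = 0 := by linear_combination h00
    simpa using this
  have hbe' : b + e = 0 := by exact_mod_cast hbe
  obtain ⟨rfl, rfl⟩ : b = 0 ∧ e = 0 := by omega
  have : r ^ 2 = 0 := by simp at h01; simpa using h01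
  have : r = 0 := by simpa using this
  simp [hr] at this
  exact ⟨this, rfl, rfl⟩

end FourthPainleve

end GenericFourthPainleve

/-- Geometric triviality part of Proposition 3.12: for `α, β ∈ ℂ` algebraically independent
over `ℚ`, if nonzero solutions `y₁, …, yₙ` of the fourth Painlevé equation
`y'' = (1/(2y))(y')² + (3/2)y³ + 4ty² + 2(t² − α)y + β/y` are such that
`y₁, y₁', …, yₙ, yₙ'` are algebraically dependent over a differential subfield `K`, then
already some pair `yᵢ, yᵢ', yⱼ, yⱼ'` (`i < j`) is algebraically dependent over `K`. -/
theorem painleveIV_geometrically_trivial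
    (α β : ℂ) (hind : AlgebraicIndependent ℚ ![α, β])
    (L : Type*) [Field L] [Algebra ℂ L]
    (D : L → L)
    (hD_add : ∀ a b : L, D (a + b) = D a + D b)
    (hD_mul : ∀ a b : L, D (a * b) = a * D b + b * D a)
    (hD_const : ∀ c : ℂ, D (algebraMap ℂ L c) = 0)
    (t : L) (hDt : D t = 1)
    (K : Subfield L)
    (hK_const : ∀ c : ℂ, algebraMap ℂ L c ∈ K)
    (hK_t : t ∈ K)
    (hK_D : ∀ a ∈ K, D a ∈ K)
    (n : ℕ) (hn : 2 ≤ n)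
    (y : Fin n → L) (hy0 : ∀ i : Fin n, y i ≠ 0)
    (hsol : ∀ i : Fin n,
      D (D (y i)) = (1 / (2 * y i)) * (D (y i)) ^ 2 + (3 / 2) * (y i) ^ 3
        + 4 * t * (y i) ^ 2 + 2 * (t ^ 2 - algebraMap ℂ L α) * y i
        + algebraMap ℂ L β / y i)
    (hdep : ¬ AlgebraicIndependent K (Sum.elim y (fun i => D (y i)))) :
    ∃ i j : Fin n, i < j ∧
      ¬ AlgebraicIndependent K ![y i, D (y i), y j, D (y j)] := by
  have : CharZero L := charZero_of_injective_algebraMap (algebraMap ℂ L).injective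
  have : Nontrivial (Fin n) := Fin.nontrivial_iff_two_le.mpr hn
  obtain ⟨c, hc⟩ := IsAlgClosed.exists_pow_nat_eq (-2 * β) (n := 2) two_pos
  have hD0 : D 0 = 0 := by simpa using hD_const 0
  have hA2 : algebraMap ℂ L 2 = 2 := map_ofNat _ 2
  let d : Der L := ⟨⟨⟨D, hD0⟩, hD_add⟩, hD_mul⟩
  have hdD (x : L) : d x = D x := rfl
  have hd2 : d 2 = 0 := by simp
  let P : PainleveData L :=
    { d := d
      s := -2 * t
      a₁ := algebraMap ℂ L c
      a₂ := algebraMap ℂ L (-α - 1 - c / 2)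
      d_s := by
        have h2 : d (-2) = 0 := by simp
        rw [Der.leibniz, h2, hdD t, hDt]
        simp
      d_a₁ := hD_const _
      d_a₂ := hD_const _
      generic := fun a b e h => by
        refine eq_zero_of_algebraicIndependent hind hc a b e ?_
        apply (algebraMap ℂ L).injective
        simpa [hA2] using h }
  let z (i : Fin n) : L := ((D (y i) - P.a₁) / y i - y i + P.s) / 2
  have hc' : P.a₁ ^ 2 = -2 * algebraMap ℂ L β := by
    simpa [hA2] using congrArg (algebraMap ℂ L) hc
  have ha₂ : P.a₂ = -algebraMap ℂ L α - 1 - P.a₁ / 2 := by simp [P, hA2]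
  have hyz (i : Fin n) : P.IsSolution (y i) (z i) := by
    have hy := hy0 i
    have h1 : P.d (y i) = y i * y i + 2 * y i * z i - P.s * y i + P.a₁ := by
      change D (y i) = _
      simp only [z]
      field_simp
      ring
    refine ⟨h1, ?_⟩
    generalize z i = w at h1 ⊢
    have h2 := congrArg P.d h1
    have h3 := hsol i
    have hd2' : P.d 2 = 0 := hd2
    simp only [map_add, map_sub, Der.leibniz, P.d_s, P.d_a₁, hd2'] at h2
    change P.d (P.d (y i)) = 1 / (2 * y i) * (P.d (y i)) ^ 2 + _ + _ + _ + _ at h3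
    have ht : P.s = -2 * t := rfl
    field_simp at h3
    apply mul_left_cancel₀ (show (2 * y i) * (2 * y i) ≠ 0 by simp [hy])
    rw [h2, h1, ht] at h3
    rw [ha₂, ht]
    rw [ht] at h1
    linear_combination h3 + hc'
  have hs : P.s ∈ K := K.mul_mem (by exact_mod_cast K.intCast_mem (-2)) hK_t
  by_contra! hpair
  refine hdep (PainleveData.algebraicIndependent_of_pairwise (P := P) hK_D hs (hK_const _)
    (hK_const _) hyz hy0 fun i j hij => ?_)
  obtain ⟨e, he, hej, hej', hei⟩ : ∃ e : Der L, (∀ a : K, e a = 0) ∧ e (y j) = 0 ∧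
      e (D (y j)) = 0 ∧ e (y i) ≠ 0 := by
    rcases hij.lt_or_gt with hlt | hlt
    · obtain ⟨e, he, hes, hei⟩ :=
        (hpair i j hlt).exists_derivation (i := 0) (s := {2, 3}) (by decide)
      exact ⟨e, he, hes 2 (by simp), hes 3 (by simp), hei⟩
    · obtain ⟨e, he, hes, hei⟩ :=
        (hpair j i hlt).exists_derivation (i := 2) (s := {0, 1}) (by decide)
      exact ⟨e, he, hes 0 (by simp), hes 1 (by simp), hei⟩
  have hz : z j ∈ Der.closure ((K : Set L) ∪ {y j, D (y j)}) :=
    (hyz j).snd_mem (hy0 j) (Der.subset_closure (.inl hs))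
      (Der.subset_closure (.inl (hK_const _))) (Der.subset_closure (by simp))
      (Der.subset_closure (by simp [P, hdD]))
  refine Der.notMem_closure.mpr ⟨e, ?_, hei⟩
  rintro _ (ha | rfl | rfl)
  · exact he ⟨_, ha⟩
  · exact hej
  · refine Der.mem_closure.mp hz e ?_
    rintro _ (ha | rfl | rfl)
    · exact he ⟨_, ha⟩
    · exact hej
    · exact hej'
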